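/- arXiv:quant-ph/0312044 — 3 statements merged into one kernel-verified Lean document; each statement's English description precedes it below -/
import Mathlib

section
/- For every n ≥ 2, the spectral order ⊑ on Ωⁿ is a partial order in which every directed subset has a supremum (a dcpo); its set of maximal elements is exactly Σⁿ, the set of pure states, and its least element is ⊥ = I/n, where I is the identity matrix. -/
open scoped ComplexOrder Matrix

/-- The Bayesian order on Δⁿ (symmetric characterization). -/
def bayesLE {n : ℕ} (x y : Fin n → ℝ) : Prop :=
  ∃ σ : Equiv.Perm (Fin n),
    Antitone (fun i => x (σ i)) ∧ Antitone (fun i => y (σ i)) ∧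
    ∀ i j : Fin n, (i : ℕ) + 1 = (j : ℕ) →
      x (σ i) * y (σ j) ≤ x (σ j) * y (σ i)

/-- Ωⁿ : density matrices on ℂⁿ. -/
def IsDensityMatrix (n : ℕ) (ρ : Matrix (Fin n) (Fin n) ℂ) : Prop :=
  ρ.PosSemidef ∧ ρ.trace = 1

def QState (n : ℕ) := {ρ : Matrix (Fin n) (Fin n) ℂ // IsDensityMatrix n ρ}

/-- The spectral order on density matrices. -/
def specLE {n : ℕ} (ρ σ : Matrix (Fin n) (Fin n) ℂ) : Prop :=
  ∃ U : Matrix (Fin n) (Fin n) ℂ, U ∈ Matrix.unitaryGroup (Fin n) ℂ ∧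
    (Uᴴ * ρ * U).IsDiag ∧ (Uᴴ * σ * U).IsDiag ∧
    bayesLE (fun i => ((Uᴴ * ρ * U) i i).re) (fun i => ((Uᴴ * σ * U) i i).re)

def qLE {n : ℕ} (ρ σ : QState n) : Prop := specLE ρ.val σ.val

/-- A pure state : spectrum contained in {0, 1}. -/
def IsPureState {n : ℕ} (ρ : Matrix (Fin n) (Fin n) ℂ) : Prop :=
  spectrum ℂ ρ ⊆ {0, 1}

/-- `a` is the supremum (least upper bound) of `S` with respect to `le`. -/
def IsLub' {α : Type*} (le : α → α → Prop) (S : Set α) (a : α) : Prop :=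
  (∀ s ∈ S, le s a) ∧ ∀ b, (∀ s ∈ S, le s b) → le a b


/-- Permutation-free form of the Bayesian order. -/
def bR {n : ℕ} (x y : Fin n → ℝ) : Prop :=
  ∀ a b, x b < x a → x a * y b ≤ x b * y a

/-- The diagonal matrix `d` conjugated by `U`. -/
noncomputable def cj {n : ℕ} (U : Matrix (Fin n) (Fin n) ℂ) (d : Fin n → ℝ) :
    Matrix (Fin n) (Fin n) ℂ :=
  U * Matrix.diagonal (fun i => (d i : ℂ)) * Uᴴ

theorem bayes_chain {n : ℕ} (x y : Fin n → ℝ) (hx : ∀ i, 0 ≤ x i) (hy : ∀ i, 0 ≤ y i)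
    (ax : Antitone x) (ay : Antitone y)
    (h : ∀ i j : Fin n, (i : ℕ) + 1 = (j : ℕ) → x i * y j ≤ x j * y i) :
    ∀ (k : ℕ) (i j : Fin n), (i : ℕ) + k = (j : ℕ) → x i * y j ≤ x j * y i := by
  intro k
  induction k with
  | zero =>
    intro i j hij
    have : i = j := Fin.ext (by omega)
    subst this; exact le_rfl
  | succ k ih =>
    intro i j hij
    have hjn := j.2
    let m : Fin n := ⟨i + k, by omega⟩
    have h1 := ih i m rfl
    have h2 := h m j (by simp only [m]; omega)
    have hmj : m ≤ j := by simp only [m, Fin.le_def]; omega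
    have hxm := ax hmj
    have hym := ay hmj
    have := hx i; have := hx j; have := hx m
    have := hy i; have := hy j; have := hy m
    rcases eq_or_lt_of_le (hy m) with h0 | h0
    · have : y j = 0 := by linarith
      rw [this, mul_zero]; positivity
    rcases eq_or_lt_of_le (hx m) with h0' | h0'
    · have hxi : x i = 0 := by
        rw [← h0', zero_mul] at h1
        nlinarith
      rw [hxi, zero_mul]; positivity
    have e : (x i * y m) * (x m * y j) ≤ (x m * y i) * (x j * y m) :=
      mul_le_mul h1 h2 (by positivity) (by positivity)
    have e2 : (x m * y m) * (x i * y j) ≤ (x m * y m) * (x j * y i) := by linarith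
    exact le_of_mul_le_mul_left e2 (by positivity)

theorem bayes_iff {n : ℕ} (x y : Fin n → ℝ) (hx : ∀ i, 0 ≤ x i) (hy : ∀ i, 0 ≤ y i) :
    bayesLE x y ↔ bR x y := by
  constructor
  · rintro ⟨σ, ax, ay, h⟩ a b hab
    have key := bayes_chain (fun i => x (σ i)) (fun i => y (σ i)) (fun i => hx _) (fun i => hy _)
      ax ay h
    have hlt : σ.symm a < σ.symm b := by
      by_contra hc
      have := ax (not_lt.mp hc)
      simp at this
      linarith
    have := key ((σ.symm b : ℕ) - σ.symm a) (σ.symm a) (σ.symm b)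
      (by have := Fin.lt_def.mp hlt; omega)
    simpa using this
  · intro h
    let f : Fin n → ℝ ×ₗ ℝ := fun i => toLex (-x i, -y i)
    have hm := Tuple.monotone_sort f
    have key : ∀ i j, i ≤ j → x (Tuple.sort f j) < x (Tuple.sort f i) ∨
        (x (Tuple.sort f i) = x (Tuple.sort f j) ∧ y (Tuple.sort f j) ≤ y (Tuple.sort f i)) := by
      intro i j hij
      have := hm hij
      simp only [f, Function.comp, Prod.Lex.toLex_le_toLex] at this
      rcases this with h | ⟨h1, h2⟩
      · left; linarith
      · right; constructor <;> linarith
    refine ⟨Tuple.sort f, ?_, ?_, ?_⟩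
    · intro i j hij
      rcases key i j hij with h | h
      · exact h.le
      · exact h.1.ge
    · intro i j hij
      rcases key i j hij with h1 | h1
      · have h2 := h _ _ h1
        have := hx (Tuple.sort f j)
        have := hy (Tuple.sort f i)
        show y (Tuple.sort f j) ≤ y (Tuple.sort f i)
        by_contra hc
        push Not at hc
        nlinarith
      · exact h1.2
    · intro i j hij
      rcases key i j (by rw [Fin.le_def]; omega) with h1 | h1
      · exact h _ _ h1
      · rw [h1.1]
        exact mul_le_mul_of_nonneg_left h1.2 (hx _)

theorem bR_zero {n : ℕ} {x y : Fin n → ℝ} (hx : x ∈ stdSimplex ℝ (Fin n))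
    (hy : y ∈ stdSimplex ℝ (Fin n)) (h : bR x y) {a : Fin n} (ha : x a = 0) : y a = 0 := by
  obtain ⟨c, hc⟩ : ∃ c, 0 < x c := by
    by_contra hc
    push Not at hc
    have := Finset.sum_nonpos (s := Finset.univ) (fun i _ => hc i)
    rw [hx.2] at this
    linarith
  have := h c a (by rw [ha]; exact hc)
  rw [ha, zero_mul] at this
  have := hy.1 a
  nlinarith

theorem bR_trans {n : ℕ} {x y z : Fin n → ℝ} (hx : x ∈ stdSimplex ℝ (Fin n))
    (hy : y ∈ stdSimplex ℝ (Fin n)) (hz : z ∈ stdSimplex ℝ (Fin n))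
    (h1 : bR x y) (h2 : bR y z) : bR x z := by
  intro a b hab
  have e1 := h1 a b hab
  have := hx.1 a; have := hx.1 b
  have := hy.1 a; have := hy.1 b
  have := hz.1 a; have := hz.1 b
  by_cases hya : y a = 0
  · have hyb : y b = 0 := by
      rw [hya, mul_zero] at e1
      nlinarith
    rw [bR_zero hy hz h2 hya, bR_zero hy hz h2 hyb]; simp
  have hya' : 0 < y a := lt_of_le_of_ne (hy.1 a) (Ne.symm hya)
  have hlt : y b < y a := by
    by_contra hc
    push Not at hc
    nlinarith
  have e2 := h2 a b hlt
  have e3 := mul_le_mul_of_nonneg_left e2 (hx.1 a)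
  have e4 := mul_le_mul_of_nonneg_right e1 (hz.1 a)
  have e5 : y a * (x a * z b) ≤ y a * (x b * z a) := by linarith
  exact le_of_mul_le_mul_left e5 hya'

theorem bR_antisymm {n : ℕ} {x y : Fin n → ℝ} (hx : x ∈ stdSimplex ℝ (Fin n))
    (hy : y ∈ stdSimplex ℝ (Fin n)) (h1 : bR x y) (h2 : bR y x) : x = y := by
  have key : ∀ a b, x b ≤ x a → x a * y b = x b * y a := by
    intro a b hab
    have := hx.1 a; have := hx.1 b
    have := hy.1 a; have := hy.1 b
    rcases eq_or_lt_of_le hab with h | h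
    · rcases lt_trichotomy (y a) (y b) with h' | h' | h'
      · have := h2 _ _ h'
        have : x a = 0 := by rw [h] at this; nlinarith
        rw [h, this]; simp
      · rw [h, h']
      · have := h2 _ _ h'
        have : x a = 0 := by rw [h] at this; nlinarith
        rw [h, this]; simp
    · have e1 := h1 _ _ h
      rcases lt_trichotomy (y a) (y b) with h' | h' | h'
      · nlinarith
      · have : y a = 0 := by rw [h'] at e1; nlinarith
        rw [← h', this]; simp
      · have e2 := h2 _ _ h'
        linarith
  have key' : ∀ a b, x a * y b = x b * y a := by
    intro a b
    rcases le_total (x b) (x a) with h | h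
    · exact key a b h
    · exact (key b a h).symm
  funext a
  have := Finset.sum_congr (rfl : (Finset.univ : Finset (Fin n)) = Finset.univ)
    (fun b _ => key' a b)
  rw [← Finset.mul_sum, ← Finset.sum_mul, hx.2, hy.2] at this
  linarith

open scoped Function in
/-- Simultaneous diagonalization. -/
theorem simul_diag {n : ℕ} {ι : Type} (T : ι → Matrix (Fin n) (Fin n) ℂ)
    (hT : ∀ i, (T i).IsHermitian) (hc : Pairwise (Commute on T)) :
    ∃ U ∈ Matrix.unitaryGroup (Fin n) ℂ, ∀ i, (Uᴴ * T i * U).IsDiag := by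
  classical
  let L : ι → Module.End ℂ (EuclideanSpace ℂ (Fin n)) := fun i => (T i).toEuclideanLin
  have hL : ∀ i, (L i).IsSymmetric := fun i => Matrix.isSymmetric_toEuclideanLin_iff.mpr (hT i)
  have hLc : Pairwise (Commute on L) := by
    intro i j hij
    have h := hc hij
    show L i * L j = L j * L i
    have h' : T i * T j = T j * T i := h
    ext v k
    have := congrFun (congrArg (fun M => M.mulVec v.ofLp) h') k
    simpa [L, Matrix.toLpLin_apply, Matrix.mulVec_mulVec] using this
  have hI := LinearMap.IsSymmetric.directSum_isInternal_of_pairwise_commute hL hLc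
  have hO := LinearMap.IsSymmetric.orthogonalFamily_iInf_eigenspaces hL
  have hf : Module.finrank ℂ (EuclideanSpace ℂ (Fin n)) = n := finrank_euclideanSpace_fin
  let P := {α : ι → ℂ // (⨅ j, Module.End.eigenspace (L j) (α j)) ≠ ⊥}
  have hO' := hO.comp (γ := P) Subtype.val_injective
  have hI' := (DirectSum.isInternal_ne_bot_iff
    (A := fun α : ι → ℂ => ⨅ j, Module.End.eigenspace (L j) (α j))).mpr hI
  let _ : Fintype P := iSupIndep.fintypeNeBotOfFiniteDimensional hO.independent
  let b := hI'.subordinateOrthonormalBasis hf hO'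
  have hb : ∀ a i, ∃ c : ℂ, (T i).mulVec (b a).ofLp = c • (b a).ofLp := by
    intro a i
    have h := hI'.subordinateOrthonormalBasis_subordinate hf a hO'
    have h2 := Module.End.mem_eigenspace_iff.mp ((Submodule.mem_iInf _).mp h i)
    refine ⟨(hI'.subordinateOrthonormalBasisIndex hf a hO').1 i, ?_⟩
    have h3 := congrArg WithLp.ofLp h2
    simpa [L, Matrix.toLpLin_apply] using h3
  let U := (EuclideanSpace.basisFun (Fin n) ℂ).toBasis.toMatrix b.toBasis
  have hU : U ∈ Matrix.unitaryGroup (Fin n) ℂ :=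
    (EuclideanSpace.basisFun (Fin n) ℂ).toMatrix_orthonormalBasis_mem_unitary b
  have hUU : Uᴴ * U = 1 := (Matrix.mem_unitaryGroup_iff').mp hU
  refine ⟨U, hU, ?_⟩
  intro i
  choose c hc' using fun a => hb a i
  have e : T i * U = U * Matrix.diagonal c := by
    ext k a
    have := congrFun (hc' a) k
    rw [Matrix.mul_diagonal]
    simp only [Matrix.mulVec, dotProduct, Pi.smul_apply, smul_eq_mul] at this
    simp only [Matrix.mul_apply]
    simp only [U, Module.Basis.toMatrix_apply, OrthonormalBasis.coe_toBasis_repr_apply, 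
      EuclideanSpace.basisFun_repr, OrthonormalBasis.coe_toBasis]
    rw [mul_comm (b a k)]
    exact this
  rw [Matrix.mul_assoc, e, ← Matrix.mul_assoc, hUU, Matrix.one_mul]
  exact Matrix.isDiag_diagonal c

section helpers

variable {n : ℕ}

theorem uni_l {U : Matrix (Fin n) (Fin n) ℂ} (hU : U ∈ Matrix.unitaryGroup (Fin n) ℂ) :
    Uᴴ * U = 1 := (Matrix.mem_unitaryGroup_iff').mp hU

theorem uni_r {U : Matrix (Fin n) (Fin n) ℂ} (hU : U ∈ Matrix.unitaryGroup (Fin n) ℂ) :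
    U * Uᴴ = 1 := (Matrix.mem_unitaryGroup_iff).mp hU

theorem conj_cj {U : Matrix (Fin n) (Fin n) ℂ} (hU : U ∈ Matrix.unitaryGroup (Fin n) ℂ)
    (d : Fin n → ℝ) : Uᴴ * cj U d * U = Matrix.diagonal (fun i => (d i : ℂ)) := by
  have h : Uᴴ * cj U d * U = (Uᴴ * U) * Matrix.diagonal (fun i => (d i : ℂ)) * (Uᴴ * U) := by
    simp only [cj, Matrix.mul_assoc]
  rw [h, uni_l hU, Matrix.one_mul, Matrix.mul_one]

theorem cj_dens {U : Matrix (Fin n) (Fin n) ℂ} (hU : U ∈ Matrix.unitaryGroup (Fin n) ℂ)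
    {d : Fin n → ℝ} (hd : d ∈ stdSimplex ℝ (Fin n)) : IsDensityMatrix n (cj U d) := by
  constructor
  · apply Matrix.PosSemidef.mul_mul_conjTranspose_same
    rw [Matrix.posSemidef_diagonal_iff]
    intro i
    exact_mod_cast hd.1 i
  · rw [cj, Matrix.trace_mul_comm, ← Matrix.mul_assoc, uni_l hU, Matrix.one_mul,
      Matrix.trace_diagonal]
    exact_mod_cast congrArg (fun r : ℝ => (r : ℂ)) hd.2

theorem cj_of_diag {ρ U : Matrix (Fin n) (Fin n) ℂ} (hρ : IsDensityMatrix n ρ)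
    (hU : U ∈ Matrix.unitaryGroup (Fin n) ℂ) (hd : (Uᴴ * ρ * U).IsDiag) :
    (fun i => ((Uᴴ * ρ * U) i i).re) ∈ stdSimplex ℝ (Fin n) ∧
      ρ = cj U (fun i => ((Uᴴ * ρ * U) i i).re) := by
  have hp : (Uᴴ * ρ * U).PosSemidef := hρ.1.conjTranspose_mul_mul_same U
  have hre : ∀ i, (((Uᴴ * ρ * U) i i).re : ℂ) = (Uᴴ * ρ * U) i i := by
    intro i
    have h0 : (0 : ℂ) ≤ (Uᴴ * ρ * U) i i := hp.diag_nonneg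
    rw [Complex.le_def] at h0
    apply Complex.ext
    · simp
    · simpa using h0.2
  have hdg : Matrix.diagonal (fun i => (((Uᴴ * ρ * U) i i).re : ℂ)) = Uᴴ * ρ * U := by
    simp only [hre]
    exact hd.diagonal_diag
  refine ⟨⟨?_, ?_⟩, ?_⟩
  · intro i
    have h0 : (0 : ℂ) ≤ (Uᴴ * ρ * U) i i := hp.diag_nonneg
    exact (Complex.le_def.mp h0).1
  · have ht : (Uᴴ * ρ * U).trace = 1 := by
      rw [Matrix.trace_mul_comm, ← Matrix.mul_assoc, uni_r hU, Matrix.one_mul, hρ.2]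
    have := congrArg Complex.re ht
    simpa [Matrix.trace] using this
  · rw [cj, hdg]
    have : U * (Uᴴ * ρ * U) * Uᴴ = (U * Uᴴ) * ρ * (U * Uᴴ) := by
      simp only [Matrix.mul_assoc]
    rw [this, uni_r hU, Matrix.one_mul, Matrix.mul_one]

theorem spec_iff {ρ σ : Matrix (Fin n) (Fin n) ℂ} (hρ : IsDensityMatrix n ρ)
    (hσ : IsDensityMatrix n σ) :
    specLE ρ σ ↔ ∃ U ∈ Matrix.unitaryGroup (Fin n) ℂ, ∃ x ∈ stdSimplex ℝ (Fin n),
      ∃ y ∈ stdSimplex ℝ (Fin n), ρ = cj U x ∧ σ = cj U y ∧ bR x y := by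
  constructor
  · rintro ⟨U, hU, h1, h2, h3⟩
    obtain ⟨a1, a2⟩ := cj_of_diag hρ hU h1
    obtain ⟨b1, b2⟩ := cj_of_diag hσ hU h2
    exact ⟨U, hU, _, a1, _, b1, a2, b2, (bayes_iff _ _ a1.1 b1.1).mp h3⟩
  · rintro ⟨U, hU, x, hx, y, hy, rfl, rfl, h⟩
    refine ⟨U, hU, ?_, ?_, ?_⟩
    · rw [conj_cj hU]; exact Matrix.isDiag_diagonal _
    · rw [conj_cj hU]; exact Matrix.isDiag_diagonal _
    · rw [conj_cj hU, conj_cj hU]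
      simpa using (bayes_iff x y hx.1 hy.1).mpr h

theorem cj_link {U V : Matrix (Fin n) (Fin n) ℂ} (hU : U ∈ Matrix.unitaryGroup (Fin n) ℂ)
    (hV : V ∈ Matrix.unitaryGroup (Fin n) ℂ) {x x' : Fin n → ℝ} (h : cj U x = cj V x')
    {i a : Fin n} (hQ : (Uᴴ * V) i a ≠ 0) : x i = x' a := by
  have e : Matrix.diagonal (fun i => (x i : ℂ)) * (Uᴴ * V) =
      (Uᴴ * V) * Matrix.diagonal (fun i => (x' i : ℂ)) := by
    rw [← conj_cj hU x, ← conj_cj hV x', ← h]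
    have e1 : Uᴴ * cj U x * U * (Uᴴ * V) = Uᴴ * cj U x * ((U * Uᴴ) * V) := by
      simp only [Matrix.mul_assoc]
    have e2 : Uᴴ * V * (Vᴴ * cj U x * V) = Uᴴ * ((V * Vᴴ) * (cj U x * V)) := by
      simp only [Matrix.mul_assoc]
    rw [e1, e2, uni_r hU, uni_r hV, Matrix.one_mul, Matrix.one_mul, Matrix.mul_assoc]
  have := congrFun (congrFun e i) a
  rw [Matrix.diagonal_mul, Matrix.mul_diagonal, mul_comm] at this
  exact_mod_cast mul_left_cancel₀ hQ this

theorem col_ne {U V : Matrix (Fin n) (Fin n) ℂ} (hU : U ∈ Matrix.unitaryGroup (Fin n) ℂ)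
    (hV : V ∈ Matrix.unitaryGroup (Fin n) ℂ) (a : Fin n) : ∃ i, (Uᴴ * V) i a ≠ 0 := by
  by_contra hc
  push Not at hc
  have e : (Uᴴ * V)ᴴ * (Uᴴ * V) = 1 := by
    have : (Uᴴ * V)ᴴ * (Uᴴ * V) = Vᴴ * ((U * Uᴴ) * V) := by
      simp only [Matrix.conjTranspose_mul, Matrix.conjTranspose_conjTranspose, Matrix.mul_assoc]
    rw [this, uni_r hU, Matrix.one_mul, uni_l hV]
  have := congrFun (congrFun e a) a
  rw [Matrix.mul_apply] at this
  simp [hc] at this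

theorem bR_change {U V : Matrix (Fin n) (Fin n) ℂ} (hU : U ∈ Matrix.unitaryGroup (Fin n) ℂ)
    (hV : V ∈ Matrix.unitaryGroup (Fin n) ℂ) {x x' y y' : Fin n → ℝ} (h : cj U x = cj V x')
    (h' : cj U y = cj V y') (hR : bR x y) : bR x' y' := by
  intro a b
  obtain ⟨i, hi⟩ := col_ne hU hV a
  obtain ⟨j, hj⟩ := col_ne hU hV b
  rw [← cj_link hU hV h hi, ← cj_link hU hV h hj, ← cj_link hU hV h' hi, ← cj_link hU hV h' hj]
  exact hR i j

theorem cj_commute {U : Matrix (Fin n) (Fin n) ℂ} (hU : U ∈ Matrix.unitaryGroup (Fin n) ℂ)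
    (x y : Fin n → ℝ) : Commute (cj U x) (cj U y) := by
  have key : ∀ x y : Fin n → ℝ, cj U x * cj U y = cj U (fun i => x i * y i) := by
    intro x y
    have : cj U x * cj U y = U * (Matrix.diagonal (fun i => (x i : ℂ)) *
        ((Uᴴ * U) * Matrix.diagonal (fun i => (y i : ℂ)))) * Uᴴ := by
      simp only [cj, Matrix.mul_assoc]
    rw [this, uni_l hU, Matrix.one_mul, Matrix.diagonal_mul_diagonal, cj]
    simp
  show _ * _ = _ * _
  rw [key, key]
  congr 1
  funext i
  ring

theorem commute_trans {U V : Matrix (Fin n) (Fin n) ℂ} (hU : U ∈ Matrix.unitaryGroup (Fin n) ℂ)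
    (hV : V ∈ Matrix.unitaryGroup (Fin n) ℂ) {x y y' z : Fin n → ℝ}
    (hy : y ∈ stdSimplex ℝ (Fin n))
    (hy' : y' ∈ stdSimplex ℝ (Fin n)) (hz : z ∈ stdSimplex ℝ (Fin n))
    (h : cj U y = cj V y') (h1 : bR x y) (h2 : bR y' z) :
    Commute (cj U x) (cj V z) := by
  set Q := Uᴴ * V with hQ
  have hQQ : Qᴴ * Q = 1 := by
    have : Qᴴ * Q = Vᴴ * ((U * Uᴴ) * V) := by
      simp only [hQ, Matrix.conjTranspose_mul, Matrix.conjTranspose_conjTranspose,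
        Matrix.mul_assoc]
    rw [this, uni_r hU, Matrix.one_mul, uni_l hV]
  set M := Qᴴ * Matrix.diagonal (fun i => (x i : ℂ)) * Q with hM
  have hMa : ∀ a b, M a b = ∑ i, star (Q i a) * (x i : ℂ) * Q i b := by
    intro a b
    rw [hM, Matrix.mul_apply]
    apply Finset.sum_congr rfl
    intro i _
    rw [Matrix.mul_diagonal, Matrix.conjTranspose_apply]
  have hM0 : ∀ a b, z a ≠ z b → M a b = 0 := by
    intro a b hab
    rw [hMa]
    by_cases hyy : y' a = y' b
    · have hpos : 0 < y' a := by
        refine lt_of_le_of_ne (hy'.1 a) (fun h0 => hab ?_)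
        rw [bR_zero hy' hz h2 h0.symm, bR_zero hy' hz h2 (hyy ▸ h0.symm)]
      obtain ⟨k, hk⟩ := col_ne hU hV a
      have hyk := cj_link hU hV h hk
      have hx : ∀ i, y i = y k → x i = x k := by
        intro i hi
        have hp : 0 < y k := hyk ▸ hpos
        rcases lt_trichotomy (x i) (x k) with h' | h' | h'
        · have := h1 _ _ h'
          rw [hi] at this
          exact absurd (le_of_mul_le_mul_right this hp) (not_le.mpr h')
        · exact h'
        · have := h1 _ _ h'
          rw [hi] at this
          exact absurd (le_of_mul_le_mul_right this hp) (not_le.mpr h')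
      have e : ∀ i, star (Q i a) * (x i : ℂ) * Q i b = (x k : ℂ) * (star (Q i a) * Q i b) := by
        intro i
        by_cases hi : Q i a = 0
        · simp [hi]
        · rw [hx i ((cj_link hU hV h hi).trans hyk.symm)]
          ring
      simp only [e]
      rw [← Finset.mul_sum]
      have hne : a ≠ b := fun hh => hab (by rw [hh])
      have := congrFun (congrFun hQQ a) b
      rw [Matrix.mul_apply, Matrix.one_apply_ne hne] at this
      simp only [Matrix.conjTranspose_apply] at this
      rw [this, mul_zero]
    · apply Finset.sum_eq_zero
      intro i _
      by_cases hia : Q i a = 0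
      · simp [hia]
      by_cases hib : Q i b = 0
      · simp [hib]
      exact absurd ((cj_link hU hV h hia).symm.trans (cj_link hU hV h hib)) hyy
  have hcomm : M * Matrix.diagonal (fun i => (z i : ℂ)) =
      Matrix.diagonal (fun i => (z i : ℂ)) * M := by
    ext a b
    rw [Matrix.mul_diagonal, Matrix.diagonal_mul]
    by_cases hab : z a = z b
    · rw [hab, mul_comm]
    · rw [hM0 a b hab]; simp
  have hx : cj U x = V * M * Vᴴ := by
    have : V * M * Vᴴ = (V * Vᴴ) * cj U x * (V * Vᴴ) := by
      simp only [hM, hQ, cj, Matrix.conjTranspose_mul, Matrix.conjTranspose_conjTranspose,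
        Matrix.mul_assoc]
    rw [this, uni_r hV, Matrix.one_mul, Matrix.mul_one]
  show _ * _ = _ * _
  have e1 : cj U x * cj V z = V * (M * ((Vᴴ * V) * Matrix.diagonal (fun i => (z i : ℂ)))) * Vᴴ := by
    rw [hx]; simp only [cj, Matrix.mul_assoc]
  have e2 : cj V z * cj U x = V * (Matrix.diagonal (fun i => (z i : ℂ)) * ((Vᴴ * V) * M)) * Vᴴ := by
    rw [hx]; simp only [cj, Matrix.mul_assoc]
  rw [e1, e2, uni_l hV, Matrix.one_mul, Matrix.one_mul, hcomm]

theorem q_trans {ρ σ τ : Matrix (Fin n) (Fin n) ℂ} (hρ : IsDensityMatrix n ρ)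
    (hσ : IsDensityMatrix n σ) (hτ : IsDensityMatrix n τ) (h1 : specLE ρ σ) (h2 : specLE σ τ) :
    specLE ρ τ := by
  rw [spec_iff hρ hσ] at h1
  rw [spec_iff hσ hτ] at h2
  obtain ⟨U, hU, x, hx, y, hy, e1, e2, hR⟩ := h1
  obtain ⟨V, hV, y', hy', z, hz, e3, e4, hR'⟩ := h2
  have c1 : Commute ρ σ := by rw [e1, e2]; exact cj_commute hU _ _
  have c2 : Commute σ τ := by rw [e3, e4]; exact cj_commute hV _ _
  have c3 : Commute ρ τ := by
    rw [e1, e4]; exact commute_trans hU hV hy hy' hz (e2.symm.trans e3) hR hR'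
  obtain ⟨W, hW, hd⟩ := simul_diag (n := n) ![ρ, σ, τ]
    (by intro i; fin_cases i
        · exact hρ.1.1
        · exact hσ.1.1
        · exact hτ.1.1)
    (by
      intro i j hij
      fin_cases i <;> fin_cases j <;> first | exact absurd rfl hij | skip
      · exact c1
      · exact c3
      · exact c1.symm
      · exact c2
      · exact c3.symm
      · exact c2.symm)
  obtain ⟨a1, a2⟩ := cj_of_diag hρ hW (hd 0)
  obtain ⟨b1, b2⟩ := cj_of_diag hσ hW (hd 1)
  obtain ⟨d1, d2⟩ := cj_of_diag hτ hW (hd 2)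
  rw [spec_iff hρ hτ]
  exact ⟨W, hW, _, a1, _, d1, a2, d2, bR_trans a1 b1 d1
    (bR_change hU hW (e1.symm.trans a2) (e2.symm.trans b2) hR)
    (bR_change hV hW (e3.symm.trans b2) (e4.symm.trans d2) hR')⟩

theorem q_antisymm {ρ σ : Matrix (Fin n) (Fin n) ℂ} (hρ : IsDensityMatrix n ρ)
    (hσ : IsDensityMatrix n σ) (h1 : specLE ρ σ) (h2 : specLE σ ρ) : ρ = σ := by
  rw [spec_iff hρ hσ] at h1
  rw [spec_iff hσ hρ] at h2
  obtain ⟨U, hU, x, hx, y, hy, e1, e2, hR⟩ := h1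
  obtain ⟨V, hV, y', hy', x', hx', e3, e4, hR'⟩ := h2
  have := bR_change hV hU (e3.symm.trans e2) (e4.symm.trans e1) hR'
  rw [e1, e2, bR_antisymm hx hy hR this]

theorem exists_cj {ρ : Matrix (Fin n) (Fin n) ℂ} (hρ : IsDensityMatrix n ρ) :
    ∃ U ∈ Matrix.unitaryGroup (Fin n) ℂ, ∃ x ∈ stdSimplex ℝ (Fin n), ρ = cj U x := by
  obtain ⟨U, hU, hd⟩ := simul_diag (n := n) (fun _ : Unit => ρ) (fun _ => hρ.1.1)
    (fun i j hij => absurd rfl hij)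
  obtain ⟨a, b⟩ := cj_of_diag hρ hU (hd ())
  exact ⟨U, hU, _, a, b⟩

theorem uni_compact : IsCompact (Matrix.unitaryGroup (Fin n) ℂ : Set (Matrix (Fin n) (Fin n) ℂ)) := by
  have hsub : (Matrix.unitaryGroup (Fin n) ℂ : Set (Matrix (Fin n) (Fin n) ℂ)) ⊆
      Set.pi Set.univ (fun _ => Set.pi Set.univ (fun _ => Metric.closedBall (0 : ℂ) 1)) := by
    intro U hU i _ j _
    have := entry_norm_bound_of_unitary hU i j
    simpa using this
  refine IsCompact.of_isClosed_subset (isCompact_univ_pi fun _ => isCompact_univ_pi fun _ =>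
    isCompact_closedBall (0 : ℂ) 1) ?_ hsub
  have : (Matrix.unitaryGroup (Fin n) ℂ : Set (Matrix (Fin n) (Fin n) ℂ)) =
      {U | U * Uᴴ = 1} := by
    ext U
    exact Matrix.mem_unitaryGroup_iff
  rw [this]
  exact isClosed_eq (by fun_prop) (by fun_prop)

theorem cj_cont : Continuous (fun p : Matrix (Fin n) (Fin n) ℂ × (Fin n → ℝ) => cj p.1 p.2) := by
  unfold cj
  refine (continuous_fst.matrix_mul (Continuous.matrix_diagonal ?_)).matrix_mul ?_
  · fun_prop
  · fun_prop

theorem dens_compact : IsCompact {ρ : Matrix (Fin n) (Fin n) ℂ | IsDensityMatrix n ρ} := by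
  have h := (uni_compact (n := n)).prod (isCompact_stdSimplex ℝ (Fin n))
  have h2 := h.image (cj_cont (n := n))
  convert h2 using 1
  ext ρ
  constructor
  · intro hρ
    obtain ⟨U, hU, x, hx, e⟩ := exists_cj hρ
    exact ⟨(U, x), ⟨hU, hx⟩, e.symm⟩
  · rintro ⟨⟨U, x⟩, ⟨hU, hx⟩, rfl⟩
    exact cj_dens hU hx

theorem spec_closed : IsClosed {p : Matrix (Fin n) (Fin n) ℂ × Matrix (Fin n) (Fin n) ℂ |
    specLE p.1 p.2} := by
  let K := (Matrix.unitaryGroup (Fin n) ℂ : Set (Matrix (Fin n) (Fin n) ℂ))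
  have : CompactSpace K := isCompact_iff_compactSpace.mp uni_compact
  let C : Set (K × (Matrix (Fin n) (Fin n) ℂ × Matrix (Fin n) (Fin n) ℂ)) :=
    {p | (p.1.1ᴴ * p.2.1 * p.1.1).IsDiag ∧ (p.1.1ᴴ * p.2.2 * p.1.1).IsDiag ∧
      bayesLE (fun i => ((p.1.1ᴴ * p.2.1 * p.1.1) i i).re)
        (fun i => ((p.1.1ᴴ * p.2.2 * p.1.1) i i).re)}
  have c1 : Continuous (fun p : K × (Matrix (Fin n) (Fin n) ℂ × Matrix (Fin n) (Fin n) ℂ) =>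
    p.1.1ᴴ * p.2.1 * p.1.1) := by fun_prop
  have c2 : Continuous (fun p : K × (Matrix (Fin n) (Fin n) ℂ × Matrix (Fin n) (Fin n) ℂ) =>
    p.1.1ᴴ * p.2.2 * p.1.1) := by fun_prop
  have hdiag : IsClosed {M : Matrix (Fin n) (Fin n) ℂ | M.IsDiag} := by
    simp only [Matrix.IsDiag, Pairwise, Set.setOf_forall]
    refine isClosed_iInter fun i => isClosed_iInter fun j => isClosed_iInter fun _ =>
      isClosed_eq (by fun_prop) continuous_const
  have hb : IsClosed {q : (Fin n → ℝ) × (Fin n → ℝ) | bayesLE q.1 q.2} := by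
    simp only [bayesLE, Set.setOf_exists]
    refine isClosed_iUnion_of_finite fun σ => ?_
    simp only [Antitone, Set.setOf_and, Set.setOf_forall]
    refine IsClosed.inter ?_ (IsClosed.inter ?_ ?_)
    · exact isClosed_iInter fun i => isClosed_iInter fun j => isClosed_iInter fun _ =>
        isClosed_le (by fun_prop) (by fun_prop)
    · exact isClosed_iInter fun i => isClosed_iInter fun j => isClosed_iInter fun _ =>
        isClosed_le (by fun_prop) (by fun_prop)
    · exact isClosed_iInter fun i => isClosed_iInter fun j => isClosed_iInter fun _ =>
        isClosed_le (by fun_prop) (by fun_prop)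
  have hC : IsClosed C := by
    refine (hdiag.preimage c1).inter ((hdiag.preimage c2).inter (hb.preimage ?_ (f := fun p :
      K × (Matrix (Fin n) (Fin n) ℂ × Matrix (Fin n) (Fin n) ℂ) =>
      ((fun i => ((p.1.1ᴴ * p.2.1 * p.1.1) i i).re),
        (fun i => ((p.1.1ᴴ * p.2.2 * p.1.1) i i).re)))))
    refine Continuous.prodMk (continuous_pi fun i => ?_) (continuous_pi fun i => ?_)
    · exact Complex.continuous_re.comp (c1.matrix_elem i i)
    · exact Complex.continuous_re.comp (c2.matrix_elem i i)
  have := isClosedMap_snd_of_compactSpace C hC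
  convert this using 1
  ext p
  constructor
  · rintro ⟨U, hU, h⟩
    exact ⟨(⟨U, hU⟩, p), h, rfl⟩
  · rintro ⟨⟨U, q⟩, h, rfl⟩
    exact ⟨U.1, U.2, h⟩

theorem q_sup (S : Set (QState n)) (hne : S.Nonempty) (hd : DirectedOn qLE S) :
    ∃ a : QState n, IsLub' qLE S a := by
  let up : S → Set (Matrix (Fin n) (Fin n) ℂ) := fun s => {M | ∃ t ∈ S, qLE s.1 t ∧ t.val = M}
  have hrefl : ∀ s : QState n, qLE s s := by
    intro s
    obtain ⟨U, hU, x, hx, e⟩ := exists_cj s.2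
    exact (spec_iff s.2 s.2).mpr ⟨U, hU, x, hx, x, hx, e, e, fun a b _ => (mul_comm _ _).le⟩
  have hsub : ∀ s, closure (up s) ⊆ {ρ | IsDensityMatrix n ρ} := by
    intro s
    refine closure_minimal ?_ dens_compact.isClosed
    rintro _ ⟨t, _, _, rfl⟩
    exact t.2
  have : Nonempty S := hne.to_subtype
  obtain ⟨a, ha⟩ := IsCompact.nonempty_iInter_of_directed_nonempty_isCompact_isClosed
    (fun s : S => closure (up s))
    (by
      intro s t
      obtain ⟨u, hu, h1, h2⟩ := hd s.1 s.2 t.1 t.2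
      refine ⟨⟨u, hu⟩, closure_mono ?_, closure_mono ?_⟩
      · rintro _ ⟨v, hv, h, rfl⟩
        exact ⟨v, hv, q_trans s.1.2 u.2 v.2 h1 h, rfl⟩
      · rintro _ ⟨v, hv, h, rfl⟩
        exact ⟨v, hv, q_trans t.1.2 u.2 v.2 h2 h, rfl⟩)
    (fun s => Set.Nonempty.closure ⟨s.1.1, s.1, s.2, hrefl _, rfl⟩)
    (fun s => dens_compact.of_isClosed_subset isClosed_closure (hsub s))
    (fun s => isClosed_closure)
  rw [Set.mem_iInter] at ha
  refine ⟨⟨a, hsub ⟨_, hne.some_mem⟩ (ha _)⟩, ?_, ?_⟩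
  · intro s hs
    have hcl : IsClosed {M : Matrix (Fin n) (Fin n) ℂ | specLE s.val M} :=
      spec_closed.preimage (f := fun M => (s.val, M)) (by fun_prop)
    refine closure_minimal ?_ hcl (ha ⟨s, hs⟩)
    rintro _ ⟨t, _, h, rfl⟩
    exact h
  · intro z hz
    have hcl : IsClosed {M : Matrix (Fin n) (Fin n) ℂ | specLE M z.val} :=
      spec_closed.preimage (f := fun M => (M, z.val)) (by fun_prop)
    refine closure_minimal ?_ hcl (ha ⟨_, hne.some_mem⟩)
    rintro _ ⟨t, ht, h, rfl⟩
    exact hz t ht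

theorem single_mem (k : Fin n) : (fun i => if i = k then (1 : ℝ) else 0) ∈ stdSimplex ℝ (Fin n) := by
  constructor
  · intro i
    dsimp only
    split_ifs <;> norm_num
  · simp

theorem cj_single_pure {U : Matrix (Fin n) (Fin n) ℂ} (hU : U ∈ Matrix.unitaryGroup (Fin n) ℂ)
    (k : Fin n) : IsPureState (cj U (fun i => if i = k then (1 : ℝ) else 0)) := by
  apply IsIdempotentElem.spectrum_subset
  show cj U _ * cj U _ = cj U _
  set d : Fin n → ℝ := fun i => if i = k then (1 : ℝ) else 0 with hd
  have : cj U d * cj U d = U * (Matrix.diagonal (fun i => (d i : ℂ)) *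
      ((Uᴴ * U) * Matrix.diagonal (fun i => (d i : ℂ)))) * Uᴴ := by
    simp only [cj, Matrix.mul_assoc]
  rw [this, uni_l hU, Matrix.one_mul, Matrix.diagonal_mul_diagonal, cj]
  congr 3
  funext i
  simp only [hd]
  split_ifs <;> simp

theorem pure_entries {U : Matrix (Fin n) (Fin n) ℂ} (hU : U ∈ Matrix.unitaryGroup (Fin n) ℂ)
    {x : Fin n → ℝ} (h : IsPureState (cj U x)) (i : Fin n) : x i = 0 ∨ x i = 1 := by
  have hm : (x i : ℂ) ∈ spectrum ℂ (cj U x) := by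
    have e := Unitary.spectrum_star_left_conjugate (R := ℂ) (a := cj U x) (U := ⟨U, hU⟩)
    have e' : star U * cj U x * U = Matrix.diagonal (fun i => (x i : ℂ)) := conj_cj hU x
    simp only at e
    rw [e', spectrum_diagonal] at e
    rw [← e]
    exact ⟨i, rfl⟩
  have := h hm
  simpa using this

end helpers

/-- (Ωⁿ, ⊑) is a dcpo whose maximal elements are exactly the pure states and whose
least element is I/n. -/
theorem quantum_states_dcpo (n : ℕ) (hn : 2 ≤ n) :
    (∀ ρ : QState n, qLE ρ ρ) ∧
    (∀ ρ σ : QState n, qLE ρ σ → qLE σ ρ → ρ = σ) ∧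
    (∀ ρ σ τ : QState n, qLE ρ σ → qLE σ τ → qLE ρ τ) ∧
    (∀ S : Set (QState n), S.Nonempty → DirectedOn qLE S →
      ∃ a : QState n, IsLub' qLE S a) ∧
    ({ρ : QState n | ∀ σ, qLE ρ σ → σ = ρ} =
      {ρ : QState n | IsPureState ρ.val}) ∧
    (∃ b : QState n, b.val = (n : ℂ)⁻¹ • (1 : Matrix (Fin n) (Fin n) ℂ) ∧
      ∀ ρ, qLE b ρ) := by
  have hrefl : ∀ s : QState n, qLE s s := by
    intro s
    obtain ⟨U, hU, x, hx, e⟩ := exists_cj s.2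
    exact (spec_iff s.2 s.2).mpr ⟨U, hU, x, hx, x, hx, e, e, fun a b _ => (mul_comm _ _).le⟩
  refine ⟨hrefl, ?_, ?_, ?_, ?_, ?_⟩
  · intro ρ σ h1 h2
    exact Subtype.ext (q_antisymm ρ.2 σ.2 h1 h2)
  · intro ρ σ τ h1 h2
    exact q_trans ρ.2 σ.2 τ.2 h1 h2
  · exact q_sup
  · ext ρ
    simp only [Set.mem_setOf_eq]
    constructor
    · intro h
      obtain ⟨U, hU, x, hx, e⟩ := exists_cj ρ.2
      have : Nonempty (Fin n) := ⟨⟨0, by omega⟩⟩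
      obtain ⟨k, hk⟩ := Finite.exists_max x
      have := h ⟨_, cj_dens hU (single_mem k)⟩ ((spec_iff ρ.2 (cj_dens hU (single_mem k))).mpr
        ⟨U, hU, x, hx, _, single_mem k, e, rfl, by
          intro a b hab
          have hb : b ≠ k := fun hb => absurd (hk a) (not_le.mpr (hb ▸ hab))
          beta_reduce
          rw [if_neg hb, mul_zero]
          exact mul_nonneg (hx.1 b) ((single_mem k).1 a)⟩)
      rw [← this]
      exact cj_single_pure hU k
    · intro hp σ hle
      obtain ⟨U, hU, x, hx, y, hy, e1, e2, hR⟩ := (spec_iff ρ.2 σ.2).mp hle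
      rw [e1] at hp
      have hent := pure_entries hU hp
      obtain ⟨k, hk⟩ : ∃ k, x k = 1 := by
        by_contra hc
        push Not at hc
        have h0 : ∀ i, x i = 0 := fun i => (hent i).resolve_right (hc i)
        have := hx.2
        simp [h0] at this
      have hx0 : ∀ b, b ≠ k → x b = 0 := by
        intro b hb
        refine (hent b).resolve_right (fun h1 => ?_)
        have h2 := Finset.sum_le_sum_of_subset_of_nonneg (f := x) (Finset.subset_univ {b, k})
          (fun i _ _ => hx.1 i)
        rw [Finset.sum_pair hb, hx.2, h1, hk] at h2
        norm_num at h2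
      have hy0 : ∀ b, b ≠ k → y b = 0 := fun b hb => bR_zero hx hy hR (hx0 b hb)
      have hyk : y k = 1 := by
        have := hy.2
        rwa [Finset.sum_eq_single k (fun b _ hb => hy0 b hb) (by simp)] at this
      have hxy : y = x := by
        funext b
        by_cases hb : b = k
        · rw [hb, hk, hyk]
        · rw [hx0 b hb, hy0 b hb]
      apply Subtype.ext
      rw [e1, e2, hxy]
  · have hn0 : (n : ℝ) ≠ 0 := by
      have : n ≠ 0 := by omega
      exact_mod_cast this
    have hm : (fun _ : Fin n => (n : ℝ)⁻¹) ∈ stdSimplex ℝ (Fin n) := by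
      constructor
      · intro i; positivity
      · simp [hn0]
    have hcj : ∀ U ∈ Matrix.unitaryGroup (Fin n) ℂ, (n : ℂ)⁻¹ • (1 : Matrix (Fin n) (Fin n) ℂ) =
        cj U (fun _ : Fin n => (n : ℝ)⁻¹) := by
      intro U hU
      have : (Matrix.diagonal (fun _ : Fin n => (((n : ℝ)⁻¹ : ℝ) : ℂ))) =
          (n : ℂ)⁻¹ • (1 : Matrix (Fin n) (Fin n) ℂ) := by
        rw [Matrix.smul_one_eq_diagonal]; simp
      rw [cj, this, Matrix.mul_smul, Matrix.mul_one, Matrix.smul_mul, uni_r hU]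
    have hb : IsDensityMatrix n ((n : ℂ)⁻¹ • (1 : Matrix (Fin n) (Fin n) ℂ)) := by
      rw [hcj 1 (one_mem _)]
      exact cj_dens (one_mem _) hm
    refine ⟨⟨_, hb⟩, rfl, ?_⟩
    intro ρ
    obtain ⟨U, hU, x, hx, e⟩ := exists_cj ρ.2
    exact (spec_iff hb ρ.2).mpr ⟨U, hU, _, hm, x, hx, hcj U hU, e,
      fun a b hab => absurd hab (lt_irrefl _)⟩
end

section
/- For every n ≥ 2, there is an order isomorphism between the order dual of (Ir(Ωⁿ), ⊑) and the set of nonzero linear subspaces of ℂⁿ ordered by inclusion. -/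
open scoped ComplexOrder Matrix

/-- The maximal elements with respect to `le`. -/
def MaxElts {α : Type*} (le : α → α → Prop) : Set α := {x | ∀ y, le x y → y = x}

/-- `a` is the infimum (greatest lower bound) of `S` with respect to `le`. -/
def IsInf' {α : Type*} (le : α → α → Prop) (S : Set α) (a : α) : Prop :=
  (∀ s ∈ S, le a s) ∧ ∀ b, (∀ s ∈ S, le b s) → le b a

/-- `x` is irreducible: the infimum of ↑x ∩ max(D) exists and equals x. -/
def Irr {α : Type*} (le : α → α → Prop) : Set α :=
  {x | IsInf' le {y | le x y ∧ y ∈ MaxElts le} x}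


namespace IrrQ

/-- `U` is unitary and its columns are eigenvectors of `ρ` with real eigenvalues `x`. -/
def Rep {n : ℕ} (ρ U : Matrix (Fin n) (Fin n) ℂ) (x : Fin n → ℝ) : Prop :=
  U ∈ Matrix.unitaryGroup (Fin n) ℂ ∧ ρ * U = U * Matrix.diagonal (fun i => (x i : ℂ))

/-- Real eigenvalues. -/
def evs {n : ℕ} (ρ : Matrix (Fin n) (Fin n) ℂ) : Set ℝ :=
  {μ | ∃ v : Fin n → ℂ, v ≠ 0 ∧ ρ *ᵥ v = (μ : ℂ) • v}

/-- The largest eigenvalue. -/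
noncomputable def lam {n : ℕ} (ρ : Matrix (Fin n) (Fin n) ℂ) : ℝ := sSup (evs ρ)

/-- The top eigenspace. -/
noncomputable def topE {n : ℕ} (ρ : Matrix (Fin n) (Fin n) ℂ) : Submodule ℂ (Fin n → ℂ) where
  carrier := {v | ρ *ᵥ v = (lam ρ : ℂ) • v}
  add_mem' := by
    intro a b ha hb
    simp only [Set.mem_ofPred_eq] at *
    rw [Matrix.mulVec_add, ha, hb, smul_add]
  zero_mem' := by simp
  smul_mem' := by
    intro c a ha
    simp only [Set.mem_ofPred_eq] at *
    rw [Matrix.mulVec_smul, ha, smul_comm]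

variable {n : ℕ} {ρ τ U P : Matrix (Fin n) (Fin n) ℂ} {x y : Fin n → ℝ}

lemma mem_topE {v : Fin n → ℂ} : v ∈ topE ρ ↔ ρ *ᵥ v = (lam ρ : ℂ) • v := Iff.rfl

lemma uu (hU : U ∈ Matrix.unitaryGroup (Fin n) ℂ) : Uᴴ * U = 1 :=
  Matrix.mem_unitaryGroup_iff'.1 hU

lemma uu' (hU : U ∈ Matrix.unitaryGroup (Fin n) ℂ) : U * Uᴴ = 1 :=
  Matrix.mem_unitaryGroup_iff.1 hU

lemma Rep.conj (h : Rep ρ U x) : Uᴴ * ρ * U = Matrix.diagonal (fun i => (x i : ℂ)) := by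
  rw [Matrix.mul_assoc, h.2, ← Matrix.mul_assoc, uu h.1, Matrix.one_mul]

lemma Rep.eq (h : Rep ρ U x) : ρ = U * Matrix.diagonal (fun i => (x i : ℂ)) * Uᴴ := by
  rw [← h.2, Matrix.mul_assoc, uu' h.1, Matrix.mul_one]

lemma rep_of_isDiag (hρ : ρ.IsHermitian) (hU : U ∈ Matrix.unitaryGroup (Fin n) ℂ)
    (h : (Uᴴ * ρ * U).IsDiag) : Rep ρ U (fun i => ((Uᴴ * ρ * U) i i).re) := by
  refine ⟨hU, ?_⟩
  have hh : (Uᴴ * ρ * U).IsHermitian := Matrix.isHermitian_conjTranspose_mul_mul U hρ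
  have : Matrix.diagonal (fun i => (((Uᴴ * ρ * U) i i).re : ℂ)) = Uᴴ * ρ * U := by
    ext i j
    by_cases hij : i = j
    · subst hij
      rw [Matrix.diagonal_apply_eq]
      exact hh.coe_re_apply_self i
    · rw [Matrix.diagonal_apply_ne _ hij, h hij]
  rw [this, ← Matrix.mul_assoc, ← Matrix.mul_assoc, uu' hU, Matrix.one_mul]

lemma Rep.perm (h : Rep ρ U x) (σ : Equiv.Perm (Fin n)) :
    Rep ρ (U.submatrix id σ) (fun i => x (σ i)) := by
  constructor
  · rw [Matrix.mem_unitaryGroup_iff']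
    have h1 := uu h.1
    have : star (U.submatrix id σ) * (U.submatrix id σ) = (Uᴴ * U).submatrix σ σ := by
      ext i j
      simp [Matrix.mul_apply, Matrix.star_apply]
    rw [this, h1]
    ext i j
    simp [Matrix.one_apply]
  · ext i j
    have := congrFun (congrFun h.2 i) (σ j)
    rw [Matrix.mul_diagonal] at this ⊢
    simpa [Matrix.mul_apply] using this

lemma specLE_out (hρ : ρ.IsHermitian) (hτ : τ.IsHermitian) (h : specLE ρ τ) :
    ∃ U x y, Rep ρ U x ∧ Rep τ U y ∧ Antitone x ∧ Antitone y ∧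
      ∀ i j : Fin n, (i : ℕ) + 1 = (j : ℕ) → x i * y j ≤ x j * y i := by
  obtain ⟨U, hU, d1, d2, σ, a1, a2, hb⟩ := h
  exact ⟨_, _, _, (rep_of_isDiag hρ hU d1).perm σ, (rep_of_isDiag hτ hU d2).perm σ, a1, a2, hb⟩

lemma specLE_in (h1 : Rep ρ U x) (h2 : Rep τ U y) (σ : Equiv.Perm (Fin n))
    (a1 : Antitone fun i => x (σ i)) (a2 : Antitone fun i => y (σ i))
    (hb : ∀ i j : Fin n, (i : ℕ) + 1 = (j : ℕ) → x (σ i) * y (σ j) ≤ x (σ j) * y (σ i)) :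
    specLE ρ τ := by
  refine ⟨U, h1.1, ?_, ?_, σ, ?_⟩
  · rw [h1.conj]; exact Matrix.isDiag_diagonal _
  · rw [h2.conj]; exact Matrix.isDiag_diagonal _
  · rw [h1.conj, h2.conj]
    simpa using ⟨a1, a2, hb⟩

lemma Rep.eig_iff (h : Rep ρ U x) (v : Fin n → ℂ) (c : ℝ) :
    ρ *ᵥ v = (c : ℂ) • v ↔ ∀ i, x i = c ∨ (Uᴴ *ᵥ v) i = 0 := by
  have e1 : ρ *ᵥ v = U *ᵥ (Matrix.diagonal (fun i => (x i : ℂ)) *ᵥ (Uᴴ *ᵥ v)) := by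
    rw [Matrix.mulVec_mulVec, Matrix.mulVec_mulVec, ← h.eq]
  have e2 : (c : ℂ) • v = U *ᵥ ((c : ℂ) • (Uᴴ *ᵥ v)) := by
    rw [Matrix.mulVec_smul, Matrix.mulVec_mulVec, uu' h.1, Matrix.one_mulVec]
  have inj : Function.Injective (fun w => U *ᵥ w) := by
    intro a b hab
    have := congrArg (fun w => Uᴴ *ᵥ w) hab
    simpa [Matrix.mulVec_mulVec, uu h.1] using this
  rw [e1, e2, inj.eq_iff (a := Matrix.diagonal (fun i => (x i : ℂ)) *ᵥ (Uᴴ *ᵥ v))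
    (b := (c : ℂ) • (Uᴴ *ᵥ v)), funext_iff]
  refine forall_congr' fun i => ?_
  rw [Matrix.mulVec_diagonal, Pi.smul_apply, smul_eq_mul, mul_eq_mul_right_iff,
    Complex.ofReal_inj]

lemma conj_col (hU : U ∈ Matrix.unitaryGroup (Fin n) ℂ) (i : Fin n) :
    Uᴴ *ᵥ (U.col i) = Pi.single i 1 := by
  rw [← Matrix.mulVec_single_one, Matrix.mulVec_mulVec, uu hU, Matrix.one_mulVec]

lemma col_ne (hU : U ∈ Matrix.unitaryGroup (Fin n) ℂ) (i : Fin n) : U.col i ≠ 0 := by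
  intro h
  have := congrFun (conj_col hU i) i
  rw [h] at this
  simp at this

lemma Rep.col_eig (h : Rep ρ U x) (i : Fin n) (c : ℝ) :
    ρ *ᵥ (U.col i) = (c : ℂ) • (U.col i) ↔ x i = c := by
  rw [h.eig_iff, conj_col h.1]
  constructor
  · intro h'
    simpa using h' i
  · intro h' j
    by_cases hj : j = i
    · subst hj; exact Or.inl h'
    · right; simp [hj]

lemma rep_of_cols (hU : U ∈ Matrix.unitaryGroup (Fin n) ℂ)
    (h : ∀ i, ρ *ᵥ (U.col i) = (x i : ℂ) • (U.col i)) : Rep ρ U x := by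
  refine ⟨hU, ?_⟩
  ext i j
  have := congrFun (h j) i
  rw [Matrix.mul_diagonal]
  rw [mul_comm]
  simpa [Matrix.mul_apply, Matrix.mulVec, dotProduct] using this

lemma Rep.evs_eq (h : Rep ρ U x) : evs ρ = Set.range x := by
  ext c
  constructor
  · rintro ⟨v, hv, e⟩
    rw [h.eig_iff] at e
    by_contra hc
    apply hv
    have : Uᴴ *ᵥ v = 0 := by
      ext i
      rcases e i with h1 | h1
      · exact absurd ⟨i, h1⟩ hc
      · exact h1
    have h2 := congrArg (fun w => U *ᵥ w) this
    simpa [Matrix.mulVec_mulVec, uu' h.1] using h2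
  · rintro ⟨i, rfl⟩
    exact ⟨U.col i, col_ne h.1 i, (h.col_eig i _).2 rfl⟩

lemma exists_rep (hρ : ρ.IsHermitian) : ∃ U x, Rep ρ U x := by
  refine ⟨hρ.eigenvectorUnitary, hρ.eigenvalues, rep_of_cols hρ.eigenvectorUnitary.2 ?_⟩
  intro i
  rw [Matrix.IsHermitian.eigenvectorUnitary_col_eq]
  exact hρ.mulVec_eigenvectorBasis i

lemma isGreatest_lam (hn : 2 ≤ n) (hρ : ρ.IsHermitian) : IsGreatest (evs ρ) (lam ρ) := by
  obtain ⟨U, x, h⟩ := exists_rep hρ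
  have hf : (evs ρ).Finite := by rw [h.evs_eq]; exact Set.finite_range x
  have hne : (evs ρ).Nonempty := by rw [h.evs_eq]; exact ⟨_, ⟨0, by omega⟩, rfl⟩
  exact ⟨hne.csSup_mem hf, fun c hc => le_csSup hf.bddAbove hc⟩

lemma topE_ne_bot (hn : 2 ≤ n) (hρ : ρ.IsHermitian) : topE ρ ≠ ⊥ := by
  obtain ⟨v, hv, e⟩ := (isGreatest_lam hn hρ).1
  exact fun h => hv ((Submodule.eq_bot_iff _).1 h v e)

lemma Rep.lam_eq (hn : 2 ≤ n) (h : Rep ρ U x) (hx : Antitone x) : lam ρ = x ⟨0, by omega⟩ := by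
  apply IsGreatest.csSup_eq
  rw [h.evs_eq]
  refine ⟨⟨_, rfl⟩, ?_⟩
  rintro _ ⟨i, rfl⟩
  exact hx (Fin.mk_le_of_le_val (Nat.zero_le _))

lemma Rep.nonneg (h : Rep ρ U x) (hρ : ρ.PosSemidef) (i : Fin n) : 0 ≤ x i := by
  have h1 : (Uᴴ * ρ * U).PosSemidef := hρ.conjTranspose_mul_mul_same U
  have h2 := h1.diag_nonneg (i := i)
  rw [h.conj, Matrix.diagonal_apply_eq] at h2
  exact_mod_cast h2

lemma Rep.sum (h : Rep ρ U x) (hρ : ρ.trace = 1) : ∑ i, x i = 1 := by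
  have h1 : (Uᴴ * ρ * U).trace = 1 := by
    rw [Matrix.mul_assoc, Matrix.trace_mul_comm, Matrix.mul_assoc, uu' h.1, Matrix.mul_one, hρ]
  rw [h.conj, Matrix.trace_diagonal] at h1
  exact_mod_cast h1

lemma Rep.pos (hn : 2 ≤ n) (h : Rep ρ U x) (hx : Antitone x) (hρ : IsDensityMatrix n ρ) :
    0 < x ⟨0, by omega⟩ := by
  by_contra hc
  have hs := h.sum hρ.2
  have : ∑ i, x i ≤ 0 := Finset.sum_nonpos fun i _ =>
    (hx (Fin.mk_le_of_le_val (Nat.zero_le _)) : x i ≤ x ⟨0, by omega⟩).trans (not_lt.1 hc)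
  linarith

/-- Monotonicity of the top eigenspace. -/
lemma topE_anti (hn : 2 ≤ n) (hρ : IsDensityMatrix n ρ) (hτ : IsDensityMatrix n τ)
    (h : specLE ρ τ) : topE τ ≤ topE ρ := by
  obtain ⟨U, x, y, rx, ry, ax, ay, hb⟩ := specLE_out hρ.1.isHermitian hτ.1.isHermitian h
  have key : ∀ k (hk : k < n), y ⟨k, hk⟩ = y ⟨0, by omega⟩ → x ⟨k, hk⟩ = x ⟨0, by omega⟩ := by
    intro k
    induction k with
    | zero => intros; rfl
    | succ k ih =>
      intro hk hy
      have hk' : k < n := by omega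
      have l1 : y ⟨k, hk'⟩ ≤ y ⟨0, by omega⟩ := ay (Fin.mk_le_of_le_val (Nat.zero_le _))
      have l2 : y ⟨k+1, hk⟩ ≤ y ⟨k, hk'⟩ := ay (by simp)
      have e1 : y ⟨k, hk'⟩ = y ⟨0, by omega⟩ := by linarith
      have e2 := ih hk' e1
      have hp := ry.pos hn ay hτ
      have := hb ⟨k, hk'⟩ ⟨k+1, hk⟩ rfl
      rw [e1, e2, hy] at this
      have h3 := le_of_mul_le_mul_right this hp
      exact le_antisymm (ax (Fin.mk_le_of_le_val (Nat.zero_le _))) h3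
  intro v hv
  rw [mem_topE, ry.lam_eq hn ay, ry.eig_iff] at hv
  rw [mem_topE, rx.lam_eq hn ax, rx.eig_iff]
  exact fun i => (hv i).imp_left (key i i.2)

lemma exists_proj (V : Submodule ℂ (Fin n → ℂ)) :
    ∃ P : Matrix (Fin n) (Fin n) ℂ, P.IsHermitian ∧ P * P = P ∧ ∀ v, P *ᵥ v = v ↔ v ∈ V := by
  let e := (WithLp.linearEquiv 2 ℂ (Fin n → ℂ)).symm
  let V' : Submodule ℂ (EuclideanSpace ℂ (Fin n)) := V.map e.toLinearMap
  let Φ := Matrix.toEuclideanCLM (n := Fin n) (𝕜 := ℂ)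
  refine ⟨Φ.symm V'.starProjection, ?_, ?_, ?_⟩
  · have h : star V'.starProjection = V'.starProjection := isSelfAdjoint_starProjection V'
    have := Φ.symm.map_star' V'.starProjection
    rw [h] at this
    exact this.symm
  · rw [← map_mul]
    congr 1
    exact V'.isIdempotentElem_starProjection
  · intro v
    have h1 : Φ (Φ.symm V'.starProjection) (WithLp.toLp 2 v)
        = WithLp.toLp 2 ((Φ.symm V'.starProjection) *ᵥ v) := Matrix.toEuclideanCLM_toLp _ _
    rw [StarAlgEquiv.apply_symm_apply] at h1
    have h2 : (WithLp.toLp 2 v : EuclideanSpace ℂ (Fin n)) ∈ V' ↔ v ∈ V := by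
      constructor
      · rintro ⟨w, hw, he⟩
        have : w = v := e.injective he
        exact this ▸ hw
      · intro hv
        exact ⟨v, hv, rfl⟩
    rw [← h2, ← Submodule.starProjection_eq_self_iff, h1]
    exact (WithLp.toLp_injective 2).eq_iff.symm

/-- `ρ` is a positive multiple `t` of the orthogonal projection `P` onto `V`. -/
def IsPi (V : Submodule ℂ (Fin n → ℂ)) (ρ P : Matrix (Fin n) (Fin n) ℂ) (t : ℝ) : Prop :=
  P.IsHermitian ∧ P * P = P ∧ (∀ v, P *ᵥ v = v ↔ v ∈ V) ∧ 0 < t ∧ ρ = (t : ℂ) • P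

lemma exists_pi (V : Submodule ℂ (Fin n → ℂ)) (hV : V ≠ ⊥) :
    ∃ (π : QState n) (P : Matrix (Fin n) (Fin n) ℂ) (t : ℝ), IsPi V π.val P t := by
  obtain ⟨P, hP, hPP, hPV⟩ := exists_proj V
  have hps : P.PosSemidef := by
    have := Matrix.posSemidef_conjTranspose_mul_self P
    rwa [hP.eq, hPP] at this
  have h0 : P ≠ 0 := by
    rintro rfl
    apply hV
    rw [Submodule.eq_bot_iff]
    intro v hv
    have := (hPV v).2 hv
    simpa using this.symm
  have htr : P.trace ≠ 0 := fun h => h0 (hps.trace_eq_zero_iff.1 h)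
  have htn := hps.trace_nonneg
  obtain ⟨r, hr, hr'⟩ : ∃ r : ℝ, 0 ≤ r ∧ P.trace = (r : ℂ) := by
    rw [Complex.nonneg_iff] at htn
    exact ⟨P.trace.re, htn.1, Complex.ext rfl (by simpa using htn.2.symm)⟩
  have hrp : 0 < r := lt_of_le_of_ne hr (by rintro rfl; exact htr (by simpa using hr'))
  refine ⟨⟨((r⁻¹ : ℝ) : ℂ) • P, ?_, ?_⟩, P, r⁻¹, hP, hPP, hPV, inv_pos.2 hrp, rfl⟩
  · apply hps.smul
    exact_mod_cast (inv_pos.2 hrp).le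
  · rw [Matrix.trace_smul, hr', smul_eq_mul, ← Complex.ofReal_mul, inv_mul_cancel₀ hrp.ne',
      Complex.ofReal_one]

lemma IsPi.evs {V : Submodule ℂ (Fin n → ℂ)} {t : ℝ} (h : IsPi V ρ P t) {c : ℝ}
    (hc : c ∈ evs ρ) : c = 0 ∨ c = t := by
  obtain ⟨hP, hPP, hPV, ht, rfl⟩ := h
  obtain ⟨v, hv, e⟩ := hc
  rw [Matrix.smul_mulVec] at e
  have e2 := congrArg (fun w => P *ᵥ w) e
  simp only [Matrix.mulVec_smul, Matrix.mulVec_mulVec, hPP] at e2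
  have e3 : (c : ℂ) • (((t:ℂ) - c) • v) = 0 := by
    have : (t : ℂ) • (c : ℂ) • v = (c : ℂ) • (c : ℂ) • v := by
      rw [← e, smul_comm (c : ℂ), ← e2]
    rw [sub_smul, smul_sub, ← this, smul_comm, sub_self]
  rcases smul_eq_zero.1 e3 with h | h
  · left; exact_mod_cast h
  · rcases smul_eq_zero.1 h with h | h
    · right
      exact_mod_cast (sub_eq_zero.1 h).symm
    · exact absurd h hv

lemma IsPi.lam {V : Submodule ℂ (Fin n → ℂ)} (hV : V ≠ ⊥) {t : ℝ} (h : IsPi V ρ P t) :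
    lam ρ = t := by
  apply IsGreatest.csSup_eq
  constructor
  · obtain ⟨v, hv, h0⟩ := Submodule.exists_mem_ne_zero_of_ne_bot hV
    refine ⟨v, h0, ?_⟩
    rw [h.2.2.2.2, Matrix.smul_mulVec, (h.2.2.1 v).2 hv]
  · intro c hc
    rcases h.evs hc with rfl | rfl
    · exact h.2.2.2.1.le
    · exact le_rfl

lemma IsPi.topE {V : Submodule ℂ (Fin n → ℂ)} (hV : V ≠ ⊥) {t : ℝ} (h : IsPi V ρ P t) :
    topE ρ = V := by
  ext v
  rw [mem_topE, h.lam hV, ← h.2.2.1 v, h.2.2.2.2, Matrix.smul_mulVec]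
  have : (t : ℂ) ≠ 0 := by exact_mod_cast h.2.2.2.1.ne'
  exact (smul_right_injective _ this).eq_iff

lemma IsPi.above (hn : 2 ≤ n) {V : Submodule ℂ (Fin n → ℂ)} {t : ℝ}
    (h : IsPi V τ P t) (hρ : ρ.PosSemidef) (hV : V ≤ IrrQ.topE ρ) : specLE ρ τ := by
  obtain ⟨hP, hPP, hPV, ht, rfl⟩ := h
  set a := IrrQ.lam ρ with ha
  have hbP : ∀ v, ρ *ᵥ (P *ᵥ v) = (a : ℂ) • (P *ᵥ v) := by
    intro v
    apply mem_topE.1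
    apply hV
    rw [← hPV, Matrix.mulVec_mulVec, hPP]
  have hbP1 : ρ * P = (a : ℂ) • P := by
    apply Matrix.ext_of_mulVec_single
    intro i
    rw [← Matrix.mulVec_mulVec, hbP, Matrix.smul_mulVec]
  have hPb : P * ρ = (a : ℂ) • P := by
    have := congrArg Matrix.conjTranspose hbP1
    simpa [Matrix.conjTranspose_mul, hP.eq, hρ.isHermitian.eq] using this
  have hH : (ρ + P).IsHermitian := hρ.isHermitian.add hP
  obtain ⟨U, μ, r⟩ := exists_rep hH
  have hg := isGreatest_lam hn hρ.isHermitian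
  have hcol : ∀ i, (μ i = a + 1 ∧ P *ᵥ U.col i = U.col i ∧ ρ *ᵥ U.col i = (a : ℂ) • U.col i) ∨
      (μ i ≤ a ∧ P *ᵥ U.col i = 0 ∧ ρ *ᵥ U.col i = (μ i : ℂ) • U.col i) := by
    intro i
    have e := (r.col_eig i (μ i)).2 rfl
    have hne := col_ne r.1 i
    generalize U.col i = u at e hne
    have e' := e
    rw [Matrix.add_mulVec] at e'
    have e2 : (a : ℂ) • (P *ᵥ u) + P *ᵥ u = (μ i : ℂ) • (P *ᵥ u) := by
      rw [← Matrix.mulVec_smul P (μ i : ℂ), ← e, Matrix.mulVec_mulVec, mul_add, hPP, hPb, Matrix.add_mulVec,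
        Matrix.smul_mulVec]
    by_cases hPu : P *ᵥ u = 0
    · right
      rw [hPu, add_zero] at e'
      exact ⟨hg.2 ⟨u, hne, e'⟩, hPu, e'⟩
    · left
      have e3 : ((a : ℂ) + 1 - μ i) • (P *ᵥ u) = 0 := by
        rw [sub_smul, add_smul, one_smul, e2, sub_self]
      have e4 : μ i = a + 1 := by
        rcases smul_eq_zero.1 e3 with h | h
        · exact_mod_cast (sub_eq_zero.1 h).symm
        · exact absurd h hPu
      have e5 : P *ᵥ u = u := by
        by_contra hc
        have hw : ρ *ᵥ (u - P *ᵥ u) = ((a + 1 : ℝ) : ℂ) • (u - P *ᵥ u) := by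
          rw [Matrix.mulVec_sub, hbP, eq_sub_of_add_eq e', e4]
          push_cast
          module
        have := hg.2 ⟨_, sub_ne_zero.2 (Ne.symm hc), hw⟩
        linarith
      refine ⟨e4, e5, ?_⟩
      rw [e5, e4] at e'
      rw [eq_sub_of_add_eq e']
      push_cast
      module
  classical
  let x : Fin n → ℝ := fun i => if μ i = a + 1 then a else μ i
  let y : Fin n → ℝ := fun i => if μ i = a + 1 then t else 0
  have rx : Rep ρ U x := by
    refine rep_of_cols r.1 fun i => ?_
    rcases hcol i with ⟨h1, h2, h3⟩ | ⟨h1, h2, h3⟩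
    · simp only [x, if_pos h1, h3]
    · have : μ i ≠ a + 1 := by intro h; linarith
      simp only [x, if_neg this, h3]
  have ry : Rep ((t : ℂ) • P) U y := by
    refine rep_of_cols r.1 fun i => ?_
    rw [Matrix.smul_mulVec]
    rcases hcol i with ⟨h1, h2, h3⟩ | ⟨h1, h2, h3⟩
    · simp only [y, if_pos h1, h2]
    · have : μ i ≠ a + 1 := by intro h; linarith
      simp [y, if_neg this, h2]
  have hμ : ∀ i, μ i = a + 1 ∨ μ i ≤ a := fun i => (hcol i).imp And.left And.left
  have hx0 := rx.nonneg hρ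
  let σ := Tuple.sort (fun i => - μ i)
  have hσ : ∀ i j, i ≤ j → μ (σ j) ≤ μ (σ i) := by
    intro i j hij
    have := Tuple.monotone_sort (fun i => - μ i) hij
    simp only [Function.comp] at this
    exact neg_le_neg_iff.1 this
  have step : ∀ i j, μ j ≤ μ i → x j ≤ x i ∧ y j ≤ y i ∧ x i * y j ≤ x j * y i := by
    intro i j hij
    have hxj := hx0 j
    simp only [x, y] at hxj ⊢
    rcases hμ i with h1 | h1 <;> rcases hμ j with h2 | h2
    · simp [h1, h2]
    · have : μ j ≠ a + 1 := by intro h; linarith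
      rw [if_neg this] at hxj
      simp only [if_pos h1, if_neg this]
      refine ⟨h2, ht.le, ?_⟩
      rw [mul_zero]; positivity
    · linarith
    · have h3 : μ j ≠ a + 1 := by intro h; linarith
      have h4 : μ i ≠ a + 1 := by intro h; linarith
      simp [h3, h4, hij]
  refine specLE_in rx ry σ ?_ ?_ ?_
  · exact fun i j hij => (step _ _ (hσ i j hij)).1
  · exact fun i j hij => (step _ _ (hσ i j hij)).2.1
  · intro i j hij
    exact (step _ _ (hσ i j (by rw [Fin.le_def]; omega))).2.2

lemma IsPi.antisymm (hn : 2 ≤ n) {V : Submodule ℂ (Fin n → ℂ)} (hV : V ≠ ⊥) {t : ℝ}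
    (h : IsPi V ρ P t) (hρ : IsDensityMatrix n ρ) (hτ : IsDensityMatrix n τ)
    (hle : specLE ρ τ) (ht : IrrQ.topE τ = V) : τ = ρ := by
  obtain ⟨U, x, y, rx, ry, ax, ay, hb⟩ := specLE_out hρ.1.isHermitian hτ.1.isHermitian hle
  have hVρ := h.topE hV
  have hx : ∀ i, x i = 0 ∨ x i = t := fun i => h.evs (by rw [rx.evs_eq]; exact ⟨i, rfl⟩)
  have hl := h.lam hV
  have h1 : ∀ i, x i = t → y i = IrrQ.lam τ := by
    intro i hi
    have : U.col i ∈ IrrQ.topE τ := by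
      rw [ht, ← hVρ, mem_topE, hl, rx.col_eig, hi]
    rw [mem_topE, ry.col_eig] at this
    exact this
  have h2 : ∀ k (hk : k < n), x ⟨k, hk⟩ = 0 → y ⟨k, hk⟩ = 0 := by
    intro k
    induction k with
    | zero =>
      intro hk h0
      have := rx.pos hn ax hρ
      linarith
    | succ k ih =>
      intro hk h0
      have hk' : k < n := by omega
      have l2 : y ⟨k+1, hk⟩ ≤ y ⟨k, hk'⟩ := ay (by simp)
      have y0 := ry.nonneg hτ.1 ⟨k+1, hk⟩
      rcases hx ⟨k, hk'⟩ with h3 | h3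
      · have := ih hk' h3
        linarith
      · have := hb ⟨k, hk'⟩ ⟨k+1, hk⟩ rfl
        rw [h3, h0, zero_mul] at this
        have htp := h.2.2.2.1
        nlinarith
  have htp := h.2.2.2.1
  have h3 : ∀ i, y i = (IrrQ.lam τ / t) * x i := by
    intro i
    rcases hx i with h4 | h4
    · rw [h4, mul_zero]; exact h2 i i.2 h4
    · rw [h4, h1 i h4]; field_simp
  have s1 := rx.sum hρ.2
  have s2 := ry.sum hτ.2
  rw [Finset.sum_congr rfl fun i _ => h3 i, ← Finset.mul_sum, s1, mul_one] at s2
  have : y = x := by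
    ext i
    rw [h3 i, s2, one_mul]
  rw [ry.eq, rx.eq, this]

/-- A chosen normalized projection onto `V`. -/
noncomputable def piS (V : Submodule ℂ (Fin n → ℂ)) (hV : V ≠ ⊥) : QState n :=
  (exists_pi V hV).choose

lemma piS_spec (V : Submodule ℂ (Fin n → ℂ)) (hV : V ≠ ⊥) :
    ∃ (P : Matrix (Fin n) (Fin n) ℂ) (t : ℝ), IsPi V (piS V hV).val P t :=
  (exists_pi V hV).choose_spec

lemma topE_piS (V : Submodule ℂ (Fin n → ℂ)) (hV : V ≠ ⊥) : topE (piS V hV).val = V := by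
  obtain ⟨P, t, h⟩ := piS_spec V hV
  exact h.topE hV

lemma le_piS (hn : 2 ≤ n) (V : Submodule ℂ (Fin n → ℂ)) (hV : V ≠ ⊥) (b : QState n)
    (h : V ≤ topE b.val) : qLE b (piS V hV) := by
  obtain ⟨P, t, hp⟩ := piS_spec V hV
  exact hp.above hn b.2.1 h

lemma eq_piS (hn : 2 ≤ n) (V : Submodule ℂ (Fin n → ℂ)) (hV : V ≠ ⊥) (b : QState n)
    (h : qLE (piS V hV) b) (ht : topE b.val = V) : b = piS V hV := by
  obtain ⟨P, t, hp⟩ := piS_spec V hV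
  exact Subtype.ext (hp.antisymm hn hV (piS V hV).2 b.2 h ht)

lemma ne_bot (hn : 2 ≤ n) (a : QState n) : topE a.val ≠ ⊥ := topE_ne_bot hn a.2.1.isHermitian

lemma le_of_irr (hn : 2 ≤ n) {a b : QState n} (ha : a ∈ Irr (qLE (n := n)))
    (h : topE a.val ≤ topE b.val) : qLE b a := by
  apply ha.2
  rintro s ⟨hs, hm⟩
  have e : piS (topE s.val) (ne_bot hn s) = s := hm _ (le_piS hn _ _ _ le_rfl)
  rw [← e]
  exact le_piS hn _ _ _ ((topE_anti hn a.2 s.2 hs).trans h)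

lemma irr_eq (hn : 2 ≤ n) {a : QState n} (ha : a ∈ Irr (qLE (n := n))) :
    a = piS (topE a.val) (ne_bot hn a) :=
  eq_piS hn _ _ _ (le_of_irr hn ha (topE_piS _ _).ge) rfl

lemma piS_max (hn : 2 ≤ n) (v : Fin n → ℂ) (hv : Submodule.span ℂ {v} ≠ ⊥) :
    piS (Submodule.span ℂ {v}) hv ∈ MaxElts (qLE (n := n)) := by
  intro s hs
  apply eq_piS hn _ _ _ hs
  have h := topE_anti hn (piS _ hv).2 s.2 hs
  rw [topE_piS] at h
  apply le_antisymm h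
  obtain ⟨w, hw, h0⟩ := Submodule.exists_mem_ne_zero_of_ne_bot (ne_bot hn s)
  obtain ⟨c, rfl⟩ := Submodule.mem_span_singleton.1 (h hw)
  rw [Submodule.span_singleton_le_iff_mem]
  have hc : c ≠ 0 := by rintro rfl; simp at h0
  exact (Submodule.smul_mem_iff _ hc).1 hw

lemma piS_irr (hn : 2 ≤ n) (V : Submodule ℂ (Fin n → ℂ)) (hV : V ≠ ⊥) :
    piS V hV ∈ Irr (qLE (n := n)) := by
  refine ⟨fun s hs => hs.1, fun b hb => le_piS hn V hV b ?_⟩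
  intro v hv
  by_cases h0 : v = 0
  · rw [h0]; exact Submodule.zero_mem _
  have hs : Submodule.span ℂ {v} ≠ ⊥ := by simpa using h0
  have h1 : qLE b (piS _ hs) := by
    refine hb _ ⟨le_piS hn _ hs _ ?_, piS_max hn v hs⟩
    rw [topE_piS, Submodule.span_singleton_le_iff_mem]
    exact hv
  have h2 := topE_anti hn b.2 (piS _ hs).2 h1
  rw [topE_piS, Submodule.span_singleton_le_iff_mem] at h2
  exact h2

end IrrQ

/-- The order dual of the irreducibles of (Ωⁿ, ⊑) is order isomorphic to the
nonzero linear subspaces of ℂⁿ ordered by inclusion. -/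
theorem irreducibles_quantum (n : ℕ) (hn : 2 ≤ n) :
    ∃ f : {ρ : QState n // ρ ∈ Irr qLE} → {V : Submodule ℂ (Fin n → ℂ) // V ≠ ⊥},
      Function.Bijective f ∧
      ∀ a b : {ρ : QState n // ρ ∈ Irr qLE},
        qLE b.val a.val ↔ (f a).val ≤ (f b).val := by
  refine ⟨fun a => ⟨IrrQ.topE a.val.val, IrrQ.ne_bot hn a.val⟩, ⟨?_, ?_⟩, ?_⟩
  · intro a b hab
    have h : IrrQ.topE a.val.val = IrrQ.topE b.val.val := congrArg Subtype.val hab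
    apply Subtype.ext
    rw [IrrQ.irr_eq hn a.2, IrrQ.irr_eq hn b.2]
    congr 1
  · rintro ⟨V, hV⟩
    exact ⟨⟨IrrQ.piS V hV, IrrQ.piS_irr hn V hV⟩, Subtype.ext (IrrQ.topE_piS V hV)⟩
  · intro a b
    exact ⟨fun h => IrrQ.topE_anti hn b.val.2 a.val.2 h, fun h => IrrQ.le_of_irr hn a.2 h⟩
end

section
/- For every n ≥ 2, von Neumann entropy σ, regarded as a map from (Ωⁿ, ⊑) to [0,∞)*, is a measurement: (i) it is Scott continuous (ρ ⊑ τ implies στ ≤ σρ, and σ(⊔S) = inf σ(S) for every directed S ⊆ Ωⁿ); (ii) σρ = 0 if and only if ρ is a maximal element of (Ωⁿ, ⊑) (i.e. a pure state); (iii) σ measures the content of every pure state: for every pure ρ ∈ Ωⁿ and every Scott-open U ⊆ Ωⁿ with ρ ∈ U there is ε > 0 such that {τ ∈ Ωⁿ : τ ⊑ ρ and στ < ε} ⊆ U. -/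
open scoped ComplexOrder Matrix

/-- `U` is Scott open: an upper set inaccessible by directed suprema. -/
def ScottOpen {α : Type*} (le : α → α → Prop) (U : Set α) : Prop :=
  (∀ x ∈ U, ∀ y, le x y → y ∈ U) ∧
  ∀ S : Set α, S.Nonempty → DirectedOn le S →
    ∀ a, IsLub' le S a → a ∈ U → (S ∩ U).Nonempty

/-- von Neumann entropy: −∑ λᵢ ln λᵢ, λᵢ the eigenvalues of ρ
(with the convention 0 · ln 0 = 0, as `Real.log 0 = 0`). -/
noncomputable def vnEntropy {n : ℕ} (ρ : QState n) : ℝ :=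
  -∑ i, ρ.prop.1.1.eigenvalues i * Real.log (ρ.prop.1.1.eigenvalues i)


/-- `U diag(x) Uᴴ`. -/
noncomputable def rep {n : ℕ} (U : Matrix (Fin n) (Fin n) ℂ) (x : Fin n → ℝ) :
    Matrix (Fin n) (Fin n) ℂ :=
  U * Matrix.diagonal (fun i => (x i : ℂ)) * Uᴴ

lemma unit_left {n : ℕ} {U : Matrix (Fin n) (Fin n) ℂ} (h : U ∈ Matrix.unitaryGroup (Fin n) ℂ) :
    Uᴴ * U = 1 := Matrix.mem_unitaryGroup_iff'.1 h

lemma unit_right {n : ℕ} {U : Matrix (Fin n) (Fin n) ℂ} (h : U ∈ Matrix.unitaryGroup (Fin n) ℂ) :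
    U * Uᴴ = 1 := Matrix.mem_unitaryGroup_iff.1 h

lemma conj_rep {n : ℕ} {U : Matrix (Fin n) (Fin n) ℂ} (h : U ∈ Matrix.unitaryGroup (Fin n) ℂ)
    (x : Fin n → ℝ) : Uᴴ * rep U x * U = Matrix.diagonal (fun i => (x i : ℂ)) := by
  unfold rep
  calc _ = (Uᴴ * U) * Matrix.diagonal (fun i => (x i : ℂ)) * (Uᴴ * U) := by
        simp only [Matrix.mul_assoc]
    _ = _ := by rw [unit_left h]; simp

/-- Two diagonalizations of the same matrix agree up to a permutation. -/
lemma diag_perm {n : ℕ} {W : Matrix (Fin n) (Fin n) ℂ} (hW : W.det ≠ 0) {x y : Fin n → ℝ}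
    (h : ∀ i j, W i j ≠ 0 → y i = x j) : ∃ σ : Equiv.Perm (Fin n), ∀ i, x i = y (σ i) := by
  rw [Matrix.det_apply] at hW
  obtain ⟨σ, -, hσ⟩ := Finset.exists_ne_zero_of_sum_ne_zero hW
  refine ⟨σ, fun i => (h _ _ ?_).symm⟩
  intro h0
  apply hσ
  have h1 : ∏ i, W (σ i) i = 0 :=
    Finset.prod_eq_zero (f := fun i => W (σ i) i) (Finset.mem_univ i) h0
  simp [h1]

lemma intertwine {n : ℕ} {U V : Matrix (Fin n) (Fin n) ℂ} (hU : U ∈ Matrix.unitaryGroup (Fin n) ℂ)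
    (hV : V ∈ Matrix.unitaryGroup (Fin n) ℂ) {x y : Fin n → ℝ} (h : rep U x = rep V y) (i j : Fin n)
    (hne : (Vᴴ * U) i j ≠ 0) : y i = x j := by
  have h1 : Vᴴ * U * Matrix.diagonal (fun i => (x i : ℂ))
      = Matrix.diagonal (fun i => (y i : ℂ)) * (Vᴴ * U) := by
    calc _ = Vᴴ * rep U x * U := by
          unfold rep
          simp only [Matrix.mul_assoc]
          rw [unit_left hU, Matrix.mul_one]
      _ = (Vᴴ * rep V y * V) * (Vᴴ * U) := by
          rw [h]
          simp only [Matrix.mul_assoc]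
          rw [← Matrix.mul_assoc V, unit_right hV, Matrix.one_mul]
      _ = _ := by rw [conj_rep hV]
  have h2 := congrFun (congrFun h1 i) j
  rw [Matrix.mul_diagonal, Matrix.diagonal_mul, mul_comm] at h2
  have := mul_right_cancel₀ hne h2
  exact_mod_cast this.symm

lemma det_unit_ne {n : ℕ} {U : Matrix (Fin n) (Fin n) ℂ}
    (h : U ∈ Matrix.unitaryGroup (Fin n) ℂ) : U.det ≠ 0 := by
  intro h0
  have := congrArg Matrix.det (unit_left h)
  rw [Matrix.det_mul, h0] at this
  simp at this

lemma rep_perm {n : ℕ} {U V : Matrix (Fin n) (Fin n) ℂ} (hU : U ∈ Matrix.unitaryGroup (Fin n) ℂ)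
    (hV : V ∈ Matrix.unitaryGroup (Fin n) ℂ) {x y : Fin n → ℝ} (h : rep U x = rep V y) :
    ∃ σ : Equiv.Perm (Fin n), ∀ i, x i = y (σ i) := by
  refine diag_perm (W := Vᴴ * U) ?_ (intertwine hU hV h)
  exact det_unit_ne (mul_mem (Unitary.star_mem hV) hU)

lemma spectral_rep {n : ℕ} {A : Matrix (Fin n) (Fin n) ℂ} (hA : A.IsHermitian) :
    A = rep (hA.eigenvectorUnitary : Matrix (Fin n) (Fin n) ℂ) hA.eigenvalues := by
  conv_lhs => rw [hA.spectral_theorem]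
  rfl

lemma entropy_rep {n : ℕ} (ρ : QState n) {U : Matrix (Fin n) (Fin n) ℂ}
    (hU : U ∈ Matrix.unitaryGroup (Fin n) ℂ) {x : Fin n → ℝ} (h : ρ.val = rep U x) :
    vnEntropy ρ = ∑ i, Real.negMulLog (x i) := by
  obtain ⟨σ, hσ⟩ := rep_perm hU (ρ.prop.1.1.eigenvectorUnitary).2
    (h.symm.trans (spectral_rep ρ.prop.1.1))
  unfold vnEntropy
  simp only [Real.negMulLog, neg_mul, Finset.sum_neg_distrib]
  rw [← Equiv.sum_comp σ]
  simp only [hσ]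

lemma rep_nonneg {n : ℕ} (ρ : QState n) {U : Matrix (Fin n) (Fin n) ℂ}
    (hU : U ∈ Matrix.unitaryGroup (Fin n) ℂ) {x : Fin n → ℝ} (h : ρ.val = rep U x) (i : Fin n) :
    0 ≤ x i := by
  have h1 := (ρ.prop.1.conjTranspose_mul_mul_same U)
  rw [h, conj_rep hU, Matrix.posSemidef_diagonal_iff] at h1
  exact_mod_cast h1 i

lemma trace_rep {n : ℕ} {U : Matrix (Fin n) (Fin n) ℂ}
    (hU : U ∈ Matrix.unitaryGroup (Fin n) ℂ) (x : Fin n → ℝ) :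
    (rep U x).trace = ((∑ i, x i : ℝ) : ℂ) := by
  unfold rep
  rw [Matrix.trace_mul_comm, ← Matrix.mul_assoc, unit_left hU, Matrix.one_mul,
    Matrix.trace_diagonal]
  push_cast
  rfl

lemma rep_sum {n : ℕ} (ρ : QState n) {U : Matrix (Fin n) (Fin n) ℂ}
    (hU : U ∈ Matrix.unitaryGroup (Fin n) ℂ) {x : Fin n → ℝ} (h : ρ.val = rep U x) :
    ∑ i, x i = 1 := by
  have h1 := ρ.prop.2
  rw [h, trace_rep hU] at h1
  exact_mod_cast h1

lemma rep_density {n : ℕ} {U : Matrix (Fin n) (Fin n) ℂ}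
    (hU : U ∈ Matrix.unitaryGroup (Fin n) ℂ) {x : Fin n → ℝ} (h0 : ∀ i, 0 ≤ x i)
    (h1 : ∑ i, x i = 1) : IsDensityMatrix n (rep U x) := by
  refine ⟨?_, ?_⟩
  · unfold rep
    apply Matrix.PosSemidef.mul_mul_conjTranspose_same
    rw [Matrix.posSemidef_diagonal_iff]
    intro i
    exact_mod_cast h0 i
  · rw [trace_rep hU, h1]; simp

/-- The density matrix with given diagonalization. -/
noncomputable def mkRep {n : ℕ} {U : Matrix (Fin n) (Fin n) ℂ}
    (hU : U ∈ Matrix.unitaryGroup (Fin n) ℂ) {x : Fin n → ℝ} (h0 : ∀ i, 0 ≤ x i)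
    (h1 : ∑ i, x i = 1) : QState n := ⟨rep U x, rep_density hU h0 h1⟩

lemma mkRep_val {n : ℕ} {U : Matrix (Fin n) (Fin n) ℂ}
    (hU : U ∈ Matrix.unitaryGroup (Fin n) ℂ) {x : Fin n → ℝ} (h0 : ∀ i, 0 ≤ x i)
    (h1 : ∑ i, x i = 1) : (mkRep hU h0 h1).val = rep U x := rfl

lemma rep_submatrix {n : ℕ} (U : Matrix (Fin n) (Fin n) ℂ) (x : Fin n → ℝ)
    (σ : Equiv.Perm (Fin n)) : rep (U.submatrix id σ) (fun i => x (σ i)) = rep U x := by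
  unfold rep
  ext i j
  rw [Matrix.mul_apply, Matrix.mul_apply]
  simp only [Matrix.mul_diagonal, Matrix.submatrix_apply, Matrix.conjTranspose_apply, id]
  exact Equiv.sum_comp σ (fun k => U i k * (x k : ℂ) * star (U j k))

lemma submatrix_unit {n : ℕ} {U : Matrix (Fin n) (Fin n) ℂ}
    (hU : U ∈ Matrix.unitaryGroup (Fin n) ℂ) (σ : Equiv.Perm (Fin n)) :
    U.submatrix id σ ∈ Matrix.unitaryGroup (Fin n) ℂ := by
  rw [Matrix.mem_unitaryGroup_iff]
  have := unit_right hU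
  rw [← this]
  ext i j
  simp only [Matrix.mul_apply, Matrix.submatrix_apply, Matrix.star_eq_conjTranspose,
    Matrix.conjTranspose_apply, id]
  exact Equiv.sum_comp σ (fun k => U i k * star (U j k))

/-- Sorted form of the spectral order. -/
def SLE {n : ℕ} (ρ τ : QState n) (U : Matrix (Fin n) (Fin n) ℂ) (x y : Fin n → ℝ) : Prop :=
  U ∈ Matrix.unitaryGroup (Fin n) ℂ ∧ ρ.val = rep U x ∧ τ.val = rep U y ∧
  Antitone x ∧ Antitone y ∧ ∀ i j : Fin n, (i : ℕ) + 1 = (j : ℕ) → x i * y j ≤ x j * y i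

lemma rep_of_diag {n : ℕ} {ρ U : Matrix (Fin n) (Fin n) ℂ} (hρ : ρ.IsHermitian)
    (hU : U ∈ Matrix.unitaryGroup (Fin n) ℂ) (hd : (Uᴴ * ρ * U).IsDiag) :
    ρ = rep U (fun i => ((Uᴴ * ρ * U) i i).re) := by
  have h1 : Matrix.diagonal (fun i => ((((Uᴴ * ρ * U) i i).re : ℝ) : ℂ)) = Uᴴ * ρ * U := by
    rw [← hd.diagonal_diag]
    congr 1
    ext i
    simp only [Matrix.diagonal_apply_eq, Matrix.diag_apply]
    exact (Matrix.isHermitian_conjTranspose_mul_mul U hρ).coe_re_apply_self i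
  unfold rep
  rw [h1]
  calc ρ = (U * Uᴴ) * ρ * (U * Uᴴ) := by rw [unit_right hU]; simp
    _ = _ := by simp only [Matrix.mul_assoc]

lemma qLE_iff {n : ℕ} (ρ τ : QState n) : qLE ρ τ ↔ ∃ U x y, SLE ρ τ U x y := by
  constructor
  · rintro ⟨U, hU, h1, h2, σ, h3, h4, h5⟩
    refine ⟨U.submatrix id σ, _, _, submatrix_unit hU σ, ?_, ?_, h3, h4, h5⟩
    · rw [rep_submatrix U (fun i => ((Uᴴ * ρ.val * U) i i).re) σ]
      exact rep_of_diag ρ.prop.1.1 hU h1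
    · rw [rep_submatrix U (fun i => ((Uᴴ * τ.val * U) i i).re) σ]
      exact rep_of_diag τ.prop.1.1 hU h2
  · rintro ⟨U, x, y, hU, h1, h2, h3, h4, h5⟩
    refine ⟨U, hU, ?_⟩
    rw [h1, h2, conj_rep hU, conj_rep hU]
    refine ⟨Matrix.isDiag_diagonal _, Matrix.isDiag_diagonal _, 1, ?_⟩
    simpa using ⟨h3, h4, h5⟩

lemma cross_trans {a b c a' b' c' : ℝ} (ha : 0 ≤ a) (hb : 0 ≤ b) (hc : 0 ≤ c)
    (ha' : 0 ≤ a') (hb' : 0 ≤ b') (hc' : 0 ≤ c') (h2 : c ≤ b) (h4 : c' ≤ b')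
    (h5 : a * b' ≤ b * a') (h6 : b * c' ≤ c * b') : a * c' ≤ c * a' := by
  rcases hb'.eq_or_lt with h | h
  · have : c' = 0 := by linarith
    subst this
    simp; positivity
  rcases hb.eq_or_lt with h0 | h0
  · subst h0
    have hc0 : c = 0 := by linarith
    subst hc0
    have : a = 0 := by
      have : a * b' = 0 := le_antisymm (by linarith) (by positivity)
      rcases mul_eq_zero.1 this with h | h <;> linarith
    subst this
    simp
  have h7 : (a * c') * (b * b') ≤ (c * a') * (b * b') := by
    calc (a * c') * (b * b') = (a * b') * (b * c') := by ring
      _ ≤ (b * a') * (c * b') := by apply mul_le_mul h5 h6 <;> positivity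
      _ = _ := by ring
  exact le_of_mul_le_mul_right h7 (by positivity)

lemma cross_all {n : ℕ} {x y : Fin n → ℝ} (hx : ∀ i, 0 ≤ x i) (hy : ∀ i, 0 ≤ y i)
    (ax : Antitone x) (ay : Antitone y)
    (h : ∀ i j : Fin n, (i : ℕ) + 1 = (j : ℕ) → x i * y j ≤ x j * y i) :
    ∀ i j, i ≤ j → x i * y j ≤ x j * y i := by
  have key : ∀ k : ℕ, ∀ i j : Fin n, (i : ℕ) + k = j → x i * y j ≤ x j * y i := by
    intro k
    induction k with
    | zero =>
      intro i j hij
      have : i = j := Fin.ext (by simpa using hij)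
      subst this
      exact le_refl _
    | succ k ih =>
      intro i j hij
      let m : Fin n := ⟨i + k, by omega⟩
      have hm : m ≤ j := by rw [Fin.le_def]; simp [m]; omega
      exact cross_trans (hx i) (hx m) (hx j) (hy i) (hy m) (hy j) (ax hm) (ay hm)
        (ih i m rfl) (h m j (by simp [m]; omega))
  intro i j hij
  exact key (j - i) i j (by rw [Fin.le_def] at hij; omega)

lemma SLE.cross {n : ℕ} {ρ τ : QState n} {U x y} (h : SLE ρ τ U x y) :
    ∀ i j, i ≤ j → x i * y j ≤ x j * y i :=
  cross_all (rep_nonneg ρ h.1 h.2.1) (rep_nonneg τ h.1 h.2.2.1) h.2.2.2.1 h.2.2.2.2.1 h.2.2.2.2.2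

lemma SLE.zero {n : ℕ} {ρ τ : QState n} {U x y} (h : SLE ρ τ U x y) :
    ∀ i, x i = 0 → y i = 0 := by
  have hc := h.cross
  obtain ⟨hU, h1, h2, h3, h4, -⟩ := h
  have x0 := rep_nonneg ρ hU h1
  have y0 := rep_nonneg τ hU h2
  have x1 := rep_sum ρ hU h1
  intro i hi
  by_contra hne
  have hyi : 0 < y i := lt_of_le_of_ne (y0 i) (Ne.symm hne)
  have : ∀ j, x j = 0 := by
    intro j
    rcases le_total i j with hij | hij
    · exact le_antisymm (hi ▸ h3 hij) (x0 j)
    · have := hc j i hij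
      rw [hi, zero_mul] at this
      have h6 := x0 j
      by_contra hh
      have : 0 < x j * y i := mul_pos (lt_of_le_of_ne h6 (Ne.symm hh)) hyi
      linarith
  simp [this] at x1

lemma entropy_mono {n : ℕ} {ρ τ : QState n} (h : qLE ρ τ) : vnEntropy τ ≤ vnEntropy ρ := by
  obtain ⟨U, x, y, h⟩ := (qLE_iff _ _).1 h
  have hc := h.cross
  have hz0 := h.zero
  obtain ⟨hU, h1, h2, h3, h4, -⟩ := h
  rw [entropy_rep ρ hU h1, entropy_rep τ hU h2]
  have x0 := rep_nonneg ρ hU h1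
  have y0 := rep_nonneg τ hU h2
  have x1 := rep_sum ρ hU h1
  have y1 := rep_sum τ hU h2
  have hz := hz0
  have hpair : ∀ i j, i ≤ j → 0 ≤ (x j * y i - x i * y j) * (Real.log (x i) - Real.log (x j)) := by
    intro i j hij
    rcases (x0 j).eq_or_lt with h0 | h0
    · rw [← h0, hz j h0.symm]; simp
    · apply mul_nonneg
      · linarith [hc i j hij]
      · linarith [Real.log_le_log h0 (h3 hij)]
  have hsum : 0 ≤ ∑ i, ∑ j, (x j * y i - x i * y j) * (Real.log (x i) - Real.log (x j)) := by
    apply Finset.sum_nonneg; intro i _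
    apply Finset.sum_nonneg; intro j _
    rcases le_total i j with hij | hij
    · exact hpair i j hij
    · have := hpair j i hij
      linarith
  have heq : ∑ i, ∑ j, (x j * y i - x i * y j) * (Real.log (x i) - Real.log (x j))
      = 2 * (∑ i, y i * Real.log (x i) - ∑ i, x i * Real.log (x i)) := by
    have e : ∀ i j, (x j * y i - x i * y j) * (Real.log (x i) - Real.log (x j))
      = (y i * Real.log (x i)) * x j - (y i) * (x j * Real.log (x j))
        - (x i * Real.log (x i)) * y j + x i * (y j * Real.log (x j)) := by
      intro i j; ring
    simp only [e, Finset.sum_add_distrib, Finset.sum_sub_distrib, ← Finset.mul_sum,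
      ← Finset.sum_mul, x1, y1]
    ring
  have hg : ∀ i, Real.negMulLog (y i) ≤ - (y i * Real.log (x i)) - y i + x i := by
    intro i
    rcases (y0 i).eq_or_lt with h0 | h0
    · rw [← h0]; simp [x0 i]
    · have hxi : 0 < x i := by
        rcases (x0 i).eq_or_lt with h | h
        · have := hz i h.symm; linarith
        · exact h
      have := Real.log_le_sub_one_of_pos (div_pos hxi h0)
      rw [Real.log_div hxi.ne' h0.ne'] at this
      have h7 := mul_le_mul_of_nonneg_left this h0.le
      have : y i * (x i / y i - 1) = x i - y i := by field_simp
      rw [this] at h7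
      unfold Real.negMulLog
      linarith
  have hgs := Finset.sum_le_sum (fun i (_ : i ∈ Finset.univ) => hg i)
  simp only [Finset.sum_add_distrib, Finset.sum_sub_distrib, Finset.sum_neg_distrib, x1, y1] at hgs
  simp only [Real.negMulLog, neg_mul, Finset.sum_neg_distrib] at hgs ⊢
  linarith

lemma rep_apply {n : ℕ} (U : Matrix (Fin n) (Fin n) ℂ) (x : Fin n → ℝ) (i j : Fin n) :
    rep U x i j = ∑ k, U i k * (x k : ℂ) * star (U j k) := by
  unfold rep
  rw [Matrix.mul_apply]
  simp only [Matrix.mul_diagonal, Matrix.conjTranspose_apply]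

lemma qLE_trans {n : ℕ} {ρ σ τ : QState n} (h1 : qLE ρ σ) (h2 : qLE σ τ) : qLE ρ τ := by
  obtain ⟨U, x, y, h1⟩ := (qLE_iff _ _).1 h1
  obtain ⟨V, y', z, h2⟩ := (qLE_iff _ _).1 h2
  have hUV : rep U y = rep V y' := h1.2.2.1.symm.trans h2.2.1
  have hyy : y = y' := by
    obtain ⟨π, hπ⟩ := rep_perm h1.1 h2.1 hUV
    have e : y = y' ∘ π := funext hπ
    have := Tuple.unique_antitone (f := y') (σ := π) (τ := 1) (e ▸ h1.2.2.2.2.1)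
      (by simpa using h2.2.2.2.1)
    rw [e, this]; rfl
  subst hyy
  have hc1 := h1.cross
  have hc2 := h2.cross
  have hz2 := h2.zero
  obtain ⟨hU, hρ, hσ, ax, ay, -⟩ := h1
  obtain ⟨hV, hσ', hτ, -, az, -⟩ := h2
  have x0 := rep_nonneg ρ hU hρ
  have y0 := rep_nonneg σ hU hσ
  have z0 := rep_nonneg τ hV hτ
  have hW := intertwine hU hV hUV
  have hxy : ∀ i j, y i = y j → y i ≠ 0 → x i = x j := by
    have : ∀ i j, i ≤ j → y i = y j → y i ≠ 0 → x i = x j := by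
      intro i j hij he hne
      have h := hc1 i j hij
      rw [← he] at h
      exact le_antisymm (le_of_mul_le_mul_right h (lt_of_le_of_ne (y0 i) (Ne.symm hne))) (ax hij)
    intro i j he hne
    rcases le_total i j with hij | hij
    · exact this i j hij he hne
    · exact (this j i hij he.symm (he ▸ hne)).symm
  let x' : Fin n → ℝ := fun k => if y k = 0 then 0 else x k
  have hWx : Vᴴ * U * Matrix.diagonal (fun i => (x' i : ℂ))
      = Matrix.diagonal (fun i => (x' i : ℂ)) * (Vᴴ * U) := by
    ext i j
    rw [Matrix.mul_diagonal, Matrix.diagonal_mul]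
    by_cases h : (Vᴴ * U) i j = 0
    · rw [h]; simp
    · have he := hW i j h
      have : x' i = x' j := by
        simp only [x']
        by_cases h0 : y i = 0
        · rw [if_pos h0, if_pos (he ▸ h0)]
        · rw [if_neg h0, if_neg (he ▸ h0), hxy i j he h0]
      rw [this, mul_comm]
  have hrep : rep V x' = rep U x' := by
    calc rep V x' = V * (Matrix.diagonal (fun i => (x' i : ℂ)) * (Vᴴ * U)) * Uᴴ := by
          unfold rep
          simp only [Matrix.mul_assoc]
          rw [unit_right hU, Matrix.mul_one]
      _ = V * (Vᴴ * U * Matrix.diagonal (fun i => (x' i : ℂ))) * Uᴴ := by rw [hWx]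
      _ = (V * Vᴴ) * rep U x' := by unfold rep; simp only [Matrix.mul_assoc]
      _ = _ := by rw [unit_right hV, Matrix.one_mul]
  let Q : Matrix (Fin n) (Fin n) ℂ := Matrix.of fun i j => if y j = 0 then U i j else V i j
  have hQ : Q ∈ Matrix.unitaryGroup (Fin n) ℂ := by
    rw [Matrix.mem_unitaryGroup_iff']
    have hVU : ∀ i j, y i ≠ y j → ∑ k, star (V k i) * U k j = 0 := by
      intro i j hne
      by_contra h
      apply hne
      apply hW i j
      simpa [Matrix.mul_apply] using h
    have hUV' : ∀ i j, y i ≠ y j → ∑ k, star (U k i) * V k j = 0 := by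
      intro i j hne
      have := congrArg star (hVU j i hne.symm)
      rw [star_sum, star_zero] at this
      rw [← this]
      apply Finset.sum_congr rfl
      intro k _
      rw [star_mul, star_star]
    have hUU : ∀ i j, ∑ k, star (U k i) * U k j = (1 : Matrix (Fin n) (Fin n) ℂ) i j := by
      intro i j
      rw [← unit_left hU]; simp [Matrix.mul_apply]
    have hVV : ∀ i j, ∑ k, star (V k i) * V k j = (1 : Matrix (Fin n) (Fin n) ℂ) i j := by
      intro i j
      rw [← unit_left hV]; simp [Matrix.mul_apply]
    ext i j
    rw [Matrix.mul_apply]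
    simp only [Matrix.star_eq_conjTranspose, Matrix.conjTranspose_apply, Q, Matrix.of_apply]
    by_cases hi : y i = 0 <;> by_cases hj : y j = 0
    · simp only [hi, hj, if_true]; exact hUU i j
    · simp only [hi, hj, if_true, if_false]
      rw [hUV' i j (by rw [hi]; exact Ne.symm hj), Matrix.one_apply_ne]
      rintro rfl; exact hj hi
    · simp only [hi, hj, if_true, if_false]
      rw [hVU i j (by rw [hj]; exact hi), Matrix.one_apply_ne]
      rintro rfl; exact hi hj
    · simp only [hi, hj, if_false]; exact hVV i j
  refine (qLE_iff _ _).2 ⟨Q, x, z, hQ, ?_, ?_, ax, az, ?_⟩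
  · rw [hρ]
    ext i j
    have e := congrFun (congrFun hrep i) j
    rw [rep_apply, rep_apply] at e
    rw [rep_apply, rep_apply]
    have e1 : ∀ k, Q i k * (x k : ℂ) * star (Q j k) = V i k * (x' k : ℂ) * star (V j k)
      + (U i k * (x k : ℂ) * star (U j k) - U i k * (x' k : ℂ) * star (U j k)) := by
      intro k
      by_cases hk : y k = 0
      · simp [Q, x', hk]
      · simp [Q, x', hk]
    rw [Finset.sum_congr rfl (fun k _ => e1 k), Finset.sum_add_distrib, Finset.sum_sub_distrib, e]
    ring
  · rw [hτ]
    ext i j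
    rw [rep_apply, rep_apply]
    apply Finset.sum_congr rfl
    intro k _
    by_cases hk : y k = 0
    · simp [hz2 k hk]
    · simp [Q, hk]
  · intro i j hij
    have hij : i ≤ j := by rw [Fin.le_def]; omega
    rcases (y0 j).eq_or_lt with h0 | h0
    · rw [hz2 j h0.symm, mul_zero]
      exact mul_nonneg (x0 _) (z0 _)
    · have h0i : 0 < y i := lt_of_lt_of_le h0 (ay hij)
      have h7 : (x i * z j) * (y i * y j) ≤ (x j * z i) * (y i * y j) := by
        calc (x i * z j) * (y i * y j) = (x i * y j) * (y i * z j) := by ring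
          _ ≤ (x j * y i) * (y j * z i) := by
            apply mul_le_mul (hc1 i j hij) (hc2 i j hij)
            · exact mul_nonneg (y0 _) (z0 _)
            · exact mul_nonneg (x0 _) (y0 _)
          _ = _ := by ring
      exact le_of_mul_le_mul_right h7 (by positivity)

lemma sorted_rep {n : ℕ} (ρ : QState n) : ∃ U ∈ Matrix.unitaryGroup (Fin n) ℂ,
    ∃ x : Fin n → ℝ, Antitone x ∧ ρ.val = rep U x := by
  let σ := Tuple.sort (fun i => - ρ.prop.1.1.eigenvalues i)
  refine ⟨_, submatrix_unit (ρ.prop.1.1.eigenvectorUnitary).2 σ,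
    fun i => ρ.prop.1.1.eigenvalues (σ i), ?_, ?_⟩
  · intro i j hij
    have := Tuple.monotone_sort (fun i => - ρ.prop.1.1.eigenvalues i) hij
    simpa [σ] using this
  · rw [rep_submatrix]; exact spectral_rep _

lemma qLE_refl {n : ℕ} (ρ : QState n) : qLE ρ ρ := by
  obtain ⟨U, hU, x, ax, h⟩ := sorted_rep ρ
  refine (qLE_iff _ _).2 ⟨U, x, x, hU, h, h, ax, ax, fun i j _ => ?_⟩
  rw [mul_comm]

lemma unitary_compact (n : ℕ) :
    IsCompact (Matrix.unitaryGroup (Fin n) ℂ : Set (Matrix (Fin n) (Fin n) ℂ)) := by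
  have hK : IsCompact (Set.univ.pi fun _ : Fin n => Set.univ.pi fun _ : Fin n =>
      Metric.closedBall (0 : ℂ) 1) :=
    isCompact_univ_pi fun _ => isCompact_univ_pi fun _ => isCompact_closedBall _ _
  refine IsCompact.of_isClosed_subset hK ?_ ?_
  · have : (Matrix.unitaryGroup (Fin n) ℂ : Set (Matrix (Fin n) (Fin n) ℂ))
      = {U | U * Uᴴ = 1} := by
      ext U; exact Matrix.mem_unitaryGroup_iff
    rw [this]
    exact isClosed_eq (by fun_prop) continuous_const
  · intro U hU i _ j _
    rw [mem_closedBall_zero_iff]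
    exact entry_norm_bound_of_unitary hU i j

lemma specLE_closed (n : ℕ) :
    IsClosed {p : Matrix (Fin n) (Fin n) ℂ × Matrix (Fin n) (Fin n) ℂ | specLE p.1 p.2} := by
  have : CompactSpace (Matrix.unitaryGroup (Fin n) ℂ : Set (Matrix (Fin n) (Fin n) ℂ)) :=
    isCompact_iff_compactSpace.1 (unitary_compact n)
  let C : Equiv.Perm (Fin n) → Set ((Matrix.unitaryGroup (Fin n) ℂ :
      Set (Matrix (Fin n) (Fin n) ℂ)) × (Matrix (Fin n) (Fin n) ℂ × Matrix (Fin n) (Fin n) ℂ)) :=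
    fun σ => {q |
      (∀ i j : Fin n, i ≠ j → ((q.1 : Matrix (Fin n) (Fin n) ℂ)ᴴ * q.2.1 * q.1) i j = 0) ∧
      (∀ i j : Fin n, i ≠ j → ((q.1 : Matrix (Fin n) (Fin n) ℂ)ᴴ * q.2.2 * q.1) i j = 0) ∧
      (∀ i j : Fin n, i ≤ j → (((q.1 : Matrix (Fin n) (Fin n) ℂ)ᴴ * q.2.1 * q.1) (σ j) (σ j)).re
        ≤ (((q.1 : Matrix (Fin n) (Fin n) ℂ)ᴴ * q.2.1 * q.1) (σ i) (σ i)).re) ∧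
      (∀ i j : Fin n, i ≤ j → (((q.1 : Matrix (Fin n) (Fin n) ℂ)ᴴ * q.2.2 * q.1) (σ j) (σ j)).re
        ≤ (((q.1 : Matrix (Fin n) (Fin n) ℂ)ᴴ * q.2.2 * q.1) (σ i) (σ i)).re) ∧
      (∀ i j : Fin n, (i : ℕ) + 1 = (j : ℕ) →
        (((q.1 : Matrix (Fin n) (Fin n) ℂ)ᴴ * q.2.1 * q.1) (σ i) (σ i)).re *
        (((q.1 : Matrix (Fin n) (Fin n) ℂ)ᴴ * q.2.2 * q.1) (σ j) (σ j)).re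
        ≤ (((q.1 : Matrix (Fin n) (Fin n) ℂ)ᴴ * q.2.1 * q.1) (σ j) (σ j)).re *
        (((q.1 : Matrix (Fin n) (Fin n) ℂ)ᴴ * q.2.2 * q.1) (σ i) (σ i)).re)}
  have c1 : Continuous (fun q : ((Matrix.unitaryGroup (Fin n) ℂ :
      Set (Matrix (Fin n) (Fin n) ℂ)) × (Matrix (Fin n) (Fin n) ℂ × Matrix (Fin n) (Fin n) ℂ)) =>
      ((q.1 : Matrix (Fin n) (Fin n) ℂ)ᴴ * q.2.1 * q.1)) := by fun_prop
  have c2 : Continuous (fun q : ((Matrix.unitaryGroup (Fin n) ℂ :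
      Set (Matrix (Fin n) (Fin n) ℂ)) × (Matrix (Fin n) (Fin n) ℂ × Matrix (Fin n) (Fin n) ℂ)) =>
      ((q.1 : Matrix (Fin n) (Fin n) ℂ)ᴴ * q.2.2 * q.1)) := by fun_prop
  have e1 := fun i j => c1.matrix_elem i j
  have e2 := fun i j => c2.matrix_elem i j
  have r1 := fun i j => Complex.continuous_re.comp (e1 i j)
  have r2 := fun i j => Complex.continuous_re.comp (e2 i j)
  have hC : ∀ σ, IsClosed (C σ) := by
    intro σ
    simp only [C, Set.ofPred_and, Set.ofPred_forall]
    refine IsClosed.inter ?_ (IsClosed.inter ?_ (IsClosed.inter ?_ (IsClosed.inter ?_ ?_)))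
    · exact isClosed_iInter fun i => isClosed_iInter fun j => isClosed_iInter fun _ =>
        isClosed_eq (e1 i j) continuous_const
    · exact isClosed_iInter fun i => isClosed_iInter fun j => isClosed_iInter fun _ =>
        isClosed_eq (e2 i j) continuous_const
    · exact isClosed_iInter fun i => isClosed_iInter fun j => isClosed_iInter fun _ =>
        isClosed_le (r1 _ _) (r1 _ _)
    · exact isClosed_iInter fun i => isClosed_iInter fun j => isClosed_iInter fun _ =>
        isClosed_le (r2 _ _) (r2 _ _)
    · exact isClosed_iInter fun i => isClosed_iInter fun j => isClosed_iInter fun _ =>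
        isClosed_le ((r1 _ _).mul (r2 _ _)) ((r1 _ _).mul (r2 _ _))
  have hU := isClosedMap_snd_of_compactSpace _ (isClosed_iUnion_of_finite hC)
  convert hU using 1
  ext p
  simp only [Set.mem_ofPred_eq, Set.mem_image, Set.mem_iUnion]
  constructor
  · rintro ⟨U, hU, h1, h2, σ, h3, h4, h5⟩
    exact ⟨(⟨U, hU⟩, p), ⟨σ, fun i j h => h1 h, fun i j h => h2 h, fun i j h => h3 h,
      fun i j h => h4 h, h5⟩, rfl⟩
  · rintro ⟨⟨⟨U, hU⟩, q⟩, ⟨σ, h1, h2, h3, h4, h5⟩, rfl⟩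
    exact ⟨U, hU, fun i j h => h1 i j h, fun i j h => h2 i j h, σ, fun i j h => h3 i j h,
      fun i j h => h4 i j h, h5⟩

lemma exists_bound {n : ℕ} (S : Set (QState n)) (hne : S.Nonempty) (hS : DirectedOn qLE S) (I : ℝ)
    (hI : ∀ s ∈ S, I ≤ vnEntropy s) : ∃ b : QState n, (∀ s ∈ S, qLE s b) ∧ I ≤ vnEntropy b := by
  have : Nonempty S := hne.to_subtype
  let C : S → Set (Matrix (Fin n) (Fin n) ℂ × (Fin n → ℝ)) := fun s =>
    ((Matrix.unitaryGroup (Fin n) ℂ : Set (Matrix (Fin n) (Fin n) ℂ)) ×ˢ stdSimplex ℝ (Fin n)) ∩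
      ({p | specLE s.1.val (rep p.1 p.2)} ∩ {p | I ≤ ∑ i, Real.negMulLog (p.2 i)})
  have hK : IsCompact ((Matrix.unitaryGroup (Fin n) ℂ : Set (Matrix (Fin n) (Fin n) ℂ)) ×ˢ
      stdSimplex ℝ (Fin n)) := (unitary_compact n).prod (isCompact_stdSimplex ℝ (Fin n))
  have hcl : ∀ s : S, IsClosed ({p : Matrix (Fin n) (Fin n) ℂ × (Fin n → ℝ) |
      specLE s.1.val (rep p.1 p.2)} ∩ {p | I ≤ ∑ i, Real.negMulLog (p.2 i)}) := by
    intro s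
    refine IsClosed.inter ?_ ?_
    · have hc : Continuous (fun p : Matrix (Fin n) (Fin n) ℂ × (Fin n → ℝ) =>
          (s.1.val, rep p.1 p.2)) := by
        unfold rep; fun_prop
      exact (specLE_closed n).preimage hc
    · exact isClosed_le continuous_const (by fun_prop)
  have hC : ∀ s, IsCompact (C s) := fun s => hK.inter_right (hcl s)
  have hne' : ∀ s, (C s).Nonempty := by
    intro s
    obtain ⟨U, hU, x, ax, h⟩ := sorted_rep s.1
    refine ⟨(U, x), ⟨hU, rep_nonneg _ hU h, rep_sum _ hU h⟩, ?_, ?_⟩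
    · have := qLE_refl s.1
      unfold qLE at this
      simp only [Set.mem_ofPred_eq]
      rw [← h]; exact this
    · have := hI s.1 s.2
      rwa [entropy_rep _ hU h] at this
  have hdir : Directed (· ⊇ ·) C := by
    intro s t
    obtain ⟨u, hu, h1, h2⟩ := hS s.1 s.2 t.1 t.2
    have key : ∀ r : QState n, qLE r u → ∀ p : Matrix (Fin n) (Fin n) ℂ × (Fin n → ℝ),
        p ∈ C ⟨u, hu⟩ → specLE r.val (rep p.1 p.2) := by
      intro r hr p hp
      exact qLE_trans (τ := mkRep hp.1.1 hp.1.2.1 hp.1.2.2) hr hp.2.1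
    exact ⟨⟨u, hu⟩, fun p hp => ⟨hp.1, key _ h1 p hp, hp.2.2⟩,
      fun p hp => ⟨hp.1, key _ h2 p hp, hp.2.2⟩⟩
  obtain ⟨p, hp⟩ := IsCompact.nonempty_iInter_of_directed_nonempty_isCompact_isClosed C hdir hne' hC
    (fun s => (hC s).isClosed)
  rw [Set.mem_iInter] at hp
  obtain ⟨s0⟩ := ‹Nonempty S›
  have h0 := hp s0
  refine ⟨mkRep h0.1.1 h0.1.2.1 h0.1.2.2, fun s hs => (hp ⟨s, hs⟩).2.1, ?_⟩
  rw [entropy_rep _ h0.1.1 (mkRep_val _ _ _)]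
  exact h0.2.2

lemma entropy_nonneg {n : ℕ} (ρ : QState n) : 0 ≤ vnEntropy ρ := by
  obtain ⟨U, hU, x, ax, h⟩ := sorted_rep ρ
  rw [entropy_rep _ hU h]
  have x0 := rep_nonneg _ hU h
  have x1 := rep_sum _ hU h
  refine Finset.sum_nonneg fun i _ => Real.negMulLog_nonneg (x0 i) ?_
  rw [← x1]
  exact Finset.single_le_sum (fun j _ => x0 j) (Finset.mem_univ i)

lemma entropy_scott {n : ℕ} (S : Set (QState n)) (hne : S.Nonempty) (hS : DirectedOn qLE S)
    (a : QState n) (ha : IsLub' qLE S a) : vnEntropy a = sInf (vnEntropy '' S) := by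
  have hbd : BddBelow (vnEntropy '' S) := ⟨0, by rintro _ ⟨s, -, rfl⟩; exact entropy_nonneg s⟩
  obtain ⟨b, hb, hI⟩ := exists_bound S hne hS (sInf (vnEntropy '' S))
    (fun s hs => csInf_le hbd ⟨s, hs, rfl⟩)
  apply le_antisymm
  · apply le_csInf (hne.image _)
    rintro _ ⟨s, hs, rfl⟩
    exact entropy_mono (ha.1 s hs)
  · exact hI.trans (entropy_mono (ha.2 b hb))

lemma entropy_max_bound {n : ℕ} {x : Fin n → ℝ} (i0 : Fin n) (x0 : ∀ i, 0 ≤ x i)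
    (x1 : ∑ i, x i = 1) (hm : ∀ i, x i ≤ x i0) : 1 - x i0 ≤ ∑ i, Real.negMulLog (x i) := by
  calc 1 - x i0 = ∑ i, x i * (1 - x i0) := by rw [← Finset.sum_mul, x1, one_mul]
    _ ≤ ∑ i, Real.negMulLog (x i) := by
      apply Finset.sum_le_sum
      intro i _
      rcases (x0 i).eq_or_lt with h | h
      · rw [← h]; simp
      · have := Real.log_le_sub_one_of_pos h
        unfold Real.negMulLog
        nlinarith [hm i]

/-- Probability vector with top entry one. -/
lemma delta_of_top {n : ℕ} {x : Fin n → ℝ} (i0 : Fin n) (x0 : ∀ i, 0 ≤ x i)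
    (x1 : ∑ i, x i = 1) (h : 1 ≤ x i0) : x = fun i => if i = i0 then 1 else 0 := by
  rw [← Finset.add_sum_erase _ _ (Finset.mem_univ i0)] at x1
  have hs : 0 ≤ ∑ i ∈ Finset.univ.erase i0, x i := Finset.sum_nonneg fun i _ => x0 i
  have h1 : x i0 = 1 := by linarith
  ext i
  by_cases hi : i = i0
  · rw [if_pos hi, hi, h1]
  · rw [if_neg hi]
    have : x i ≤ ∑ i ∈ Finset.univ.erase i0, x i :=
      Finset.single_le_sum (fun j _ => x0 j) (Finset.mem_erase.2 ⟨hi, Finset.mem_univ _⟩)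
    linarith [x0 i]

lemma delta_props {n : ℕ} (i0 : Fin n) : (∀ i, (0 : ℝ) ≤ if i = i0 then 1 else 0) ∧
    ∑ i, (if i = i0 then (1 : ℝ) else 0) = 1 := by
  refine ⟨fun i => by split_ifs <;> norm_num, by simp⟩

lemma entropy_zero_iff {n : ℕ} (hn : 2 ≤ n) (ρ : QState n) :
    vnEntropy ρ = 0 ↔ (∀ τ, qLE ρ τ → τ = ρ) := by
  let i0 : Fin n := ⟨0, by omega⟩
  have hi0 : ∀ i : Fin n, i0 ≤ i := fun i => by rw [Fin.le_def]; simp [i0]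
  constructor
  · intro h0 τ hle
    obtain ⟨U, x, y, h⟩ := (qLE_iff _ _).1 hle
    have hz := h.zero
    obtain ⟨hU, h1, h2, h3, h4, -⟩ := h
    rw [entropy_rep _ hU h1] at h0
    have x0 := rep_nonneg _ hU h1
    have x1 := rep_sum _ hU h1
    have y1 := rep_sum _ hU h2
    have hb := entropy_max_bound i0 x0 x1 (fun i => h3 (hi0 i))
    have hx := delta_of_top i0 x0 x1 (by linarith)
    have hy0 : ∀ i, i ≠ i0 → y i = 0 := by
      intro i hi
      apply hz
      rw [hx]; simp [hi]
    have hyi : y i0 = 1 := by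
      rw [← y1]
      exact (Finset.sum_eq_single i0 (fun i _ hi => hy0 i hi) (by simp)).symm
    have hy := delta_of_top i0 (rep_nonneg _ hU h2) y1 hyi.ge
    apply Subtype.ext
    rw [h1, h2, hx, hy]
  · intro hmax
    obtain ⟨U, hU, x, ax, h⟩ := sorted_rep ρ
    have x0 := rep_nonneg _ hU h
    have hle : qLE ρ (mkRep hU (delta_props i0).1 (delta_props i0).2) := by
      refine (qLE_iff _ _).2 ⟨U, x, _, hU, h, mkRep_val _ _ _, ax, ?_, ?_⟩
      · intro i j hij
        by_cases hi : i = i0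
        · simp only [hi, if_true]; split_ifs <;> norm_num
        · have hj : j ≠ i0 := by
            rintro rfl; exact hi (le_antisymm hij (hi0 i))
          simp [hi, hj]
      · intro i j hij
        have hj : j ≠ i0 := by
          rintro rfl; simp [i0] at hij
        simp only [hj, if_false, mul_zero]
        exact mul_nonneg (x0 _) ((delta_props i0).1 i)
    rw [← hmax _ hle, entropy_rep _ hU (mkRep_val _ _ _)]
    apply Finset.sum_eq_zero
    intro i _
    split_ifs <;> simp

lemma pure_delta {n : ℕ} (i0 : Fin n) (hi0 : ∀ i, i0 ≤ i) (ρ : QState n) (hp : IsPureState ρ.val)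
    {U : Matrix (Fin n) (Fin n) ℂ} (hU : U ∈ Matrix.unitaryGroup (Fin n) ℂ) {y : Fin n → ℝ}
    (ay : Antitone y) (h : ρ.val = rep U y) : y = fun i => if i = i0 then 1 else 0 := by
  obtain ⟨σ, hσ⟩ := rep_perm hU (ρ.prop.1.1.eigenvectorUnitary).2
    (h.symm.trans (spectral_rep ρ.prop.1.1))
  have y0 := rep_nonneg _ hU h
  have y1 := rep_sum _ hU h
  have h01 : ∀ i, y i = 0 ∨ y i = 1 := by
    intro i
    have hm : ((y i : ℝ) : ℂ) ∈ spectrum ℂ ρ.val := by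
      rw [ρ.prop.1.1.spectrum_eq_image_range]
      exact ⟨y i, ⟨σ i, (hσ i).symm⟩, rfl⟩
    rcases hp hm with h | h
    · left; exact_mod_cast h
    · right; exact_mod_cast (Set.mem_singleton_iff.1 h)
  refine delta_of_top i0 y0 y1 ?_
  rcases h01 i0 with h | h
  · exfalso
    have : ∀ i, y i = 0 := fun i => le_antisymm (h ▸ ay (hi0 i)) (y0 i)
    simp [this] at y1
  · exact h.ge

/-- Mixing a delta vector with the uniform one. -/
noncomputable def mix {n : ℕ} (i0 : Fin n) (t : ℝ) : Fin n → ℝ :=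
  fun i => t * (if i = i0 then 1 else 0) + (1 - t) / n

lemma mix_nonneg {n : ℕ} (i0 : Fin n) {t : ℝ} (h0 : 0 ≤ t) (h1 : t ≤ 1) (i : Fin n) :
    0 ≤ mix i0 t i := by
  unfold mix
  have := (delta_props i0).1 i
  have : 0 ≤ 1 - t := by linarith
  positivity

lemma mix_sum {n : ℕ} (i0 : Fin n) (t : ℝ) : ∑ i, mix i0 t i = 1 := by
  unfold mix
  have : (n : ℝ) ≠ 0 := by
    have := i0.pos
    positivity
  rw [Finset.sum_add_distrib, ← Finset.mul_sum, (delta_props i0).2]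
  simp
  field_simp
  ring

lemma mix_antitone {n : ℕ} (i0 : Fin n) (hi0 : ∀ i, i0 ≤ i) {t : ℝ} (h0 : 0 ≤ t) :
    Antitone (mix i0 t) := by
  intro i j hij
  unfold mix
  by_cases hj : j = i0
  · have : i = i0 := le_antisymm (hj ▸ hij) (hi0 i)
    simp [hj, this]
  · have := mul_nonneg h0 ((delta_props i0).1 i)
    simp only [hj, if_false]
    linarith

lemma rep_mix {n : ℕ} (i0 : Fin n) (t : ℝ) {U : Matrix (Fin n) (Fin n) ℂ}
    (hU : U ∈ Matrix.unitaryGroup (Fin n) ℂ) :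
    rep U (mix i0 t) = (t : ℂ) • rep U (fun i => if i = i0 then 1 else 0)
      + (((1 - t) / n : ℝ) : ℂ) • (1 : Matrix (Fin n) (Fin n) ℂ) := by
  rw [← unit_right hU]
  ext i j
  simp only [Matrix.add_apply, Matrix.smul_apply, rep_apply, Matrix.mul_apply,
    Matrix.conjTranspose_apply, smul_eq_mul, Finset.mul_sum]
  rw [← Finset.sum_add_distrib]
  apply Finset.sum_congr rfl
  intro k _
  unfold mix
  push_cast
  ring

lemma measures {n : ℕ} (hn : 2 ≤ n) (ρ : QState n) (hp : IsPureState ρ.val)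
    (O : Set (QState n)) (hO : ScottOpen qLE O) (hρ : ρ ∈ O) :
    ∃ ε > (0 : ℝ), {τ : QState n | qLE τ ρ ∧ vnEntropy τ < ε} ⊆ O := by
  let i0 : Fin n := ⟨0, by omega⟩
  have hi0 : ∀ i : Fin n, i0 ≤ i := fun i => by rw [Fin.le_def]; simp [i0]
  have hnpos : (0 : ℝ) < n := by
    have : 0 < n := by omega
    exact_mod_cast this
  obtain ⟨U, hU, y, ay, hy⟩ := sorted_rep ρ
  have hyd := pure_delta i0 hi0 ρ hp hU ay hy
  subst hyd
  let d : Set.Ico (0 : ℝ) 1 → QState n := fun t =>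
    mkRep hU (mix_nonneg i0 t.2.1 t.2.2.le) (mix_sum i0 t)
  have hd : ∀ t, (d t).val = rep U (mix i0 t) := fun t => mkRep_val _ _ _
  have hj0 : ∀ i j : Fin n, (i : ℕ) + 1 = j → j ≠ i0 := by
    rintro i j hij rfl; simp [i0] at hij
  have hmono : ∀ s t : Set.Ico (0 : ℝ) 1, (s : ℝ) ≤ t → qLE (d s) (d t) := by
    intro s t hst
    refine (qLE_iff _ _).2 ⟨U, _, _, hU, hd s, hd t, mix_antitone i0 hi0 s.2.1,
      mix_antitone i0 hi0 t.2.1, ?_⟩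
    intro i j hij
    have hj := hj0 i j hij
    obtain ⟨s, hs0, hs1⟩ := s
    obtain ⟨t, ht0, ht1⟩ := t
    simp only at hst
    simp only [mix, hj, if_false, mul_zero, zero_add]
    have he := (delta_props i0).1 i
    generalize (if i = i0 then (1 : ℝ) else 0) = e at he
    have : ((1 - s) / n) * (t * e + (1 - t) / n) - (s * e + (1 - s) / n) * ((1 - t) / n)
      = e * (t - s) / n := by field_simp; ring
    have h2 : 0 ≤ e * (t - s) / n := by
      have : 0 ≤ t - s := by linarith
      positivity
    linarith
  have hlub : IsLub' qLE (Set.range d) ρ := by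
    constructor
    · rintro _ ⟨t, rfl⟩
      refine (qLE_iff _ _).2 ⟨U, _, _, hU, hd t, hy, mix_antitone i0 hi0 t.2.1, ay, ?_⟩
      intro i j hij
      have hj := hj0 i j hij
      simp only [hj, if_false, mul_zero]
      exact mul_nonneg (mix_nonneg i0 t.2.1 t.2.2.le _) ((delta_props i0).1 i)
    · intro b hb
      have hc : Continuous (fun t : ℝ => (rep U (mix i0 t), b.val)) := by
        unfold rep mix
        fun_prop
      have hcl := (specLE_closed n).preimage hc
      have hsub : Set.Ico (0 : ℝ) 1 ⊆ (fun t : ℝ => (rep U (mix i0 t), b.val)) ⁻¹'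
          {p : Matrix (Fin n) (Fin n) ℂ × Matrix (Fin n) (Fin n) ℂ | specLE p.1 p.2} := by
        intro t ht
        exact hb (d ⟨t, ht⟩) ⟨_, rfl⟩
      have h1 := closure_minimal hsub hcl
      rw [closure_Ico (by norm_num)] at h1
      have h2 : specLE (rep U (mix i0 1)) b.val := h1 (⟨zero_le_one, le_refl _⟩)
      have h3 : rep U (mix i0 1) = ρ.val := by
        rw [hy]; congr 1; ext i; simp [mix]
      unfold qLE
      rw [← h3]; exact h2
  have hdir : DirectedOn qLE (Set.range d) := by
    rintro _ ⟨s, rfl⟩ _ ⟨t, rfl⟩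
    rcases le_total (s : ℝ) t with h | h
    · exact ⟨d t, ⟨t, rfl⟩, hmono s t h, qLE_refl _⟩
    · exact ⟨d s, ⟨s, rfl⟩, qLE_refl _, hmono t s h⟩
  obtain ⟨_, ⟨t, rfl⟩, htO⟩ := hO.2 (Set.range d) ⟨d ⟨0, by norm_num⟩, ⟨_, rfl⟩⟩ hdir ρ hlub hρ
  obtain ⟨t, ht0, ht1⟩ := t
  let q : ℝ := (1 - t) / n
  have hq : 0 < q := div_pos (by linarith) hnpos
  let p : ℝ := t + q
  have hppos : 0 < p := by positivity
  refine ⟨q / (p + q), by positivity, ?_⟩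
  rintro τ ⟨hτ, hε⟩
  obtain ⟨V, x, y, hV, h1, h2, h3, h4, -⟩ := (qLE_iff _ _).1 hτ
  have hyd := pure_delta i0 hi0 ρ hp hV h4 h2
  subst hyd
  have x0 := rep_nonneg _ hV h1
  have x1 := rep_sum _ hV h1
  have hb := entropy_max_bound i0 x0 x1 (fun i => h3 (hi0 i))
  rw [entropy_rep _ hV h1] at hε
  have hx : p ≤ (p + q) * x i0 := by
    have h5 : 1 - x i0 < q / (p + q) := lt_of_le_of_lt hb hε
    rw [lt_div_iff₀ (by positivity)] at h5
    linarith
  refine hO.1 _ htO τ ((qLE_iff _ _).2 ⟨V, mix i0 t, x, hV, ?_, h1, mix_antitone i0 hi0 ht0, h3, ?_⟩)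
  · rw [hd, rep_mix i0 _ hU, rep_mix i0 _ hV, ← hy, ← h2]
  · intro i j hij
    have hj := hj0 i j hij
    have hij' : i ≤ j := by rw [Fin.le_def]; omega
    simp only [mix, hj, if_false, mul_zero, zero_add]
    by_cases hi : i = i0
    · rw [if_pos hi, hi, mul_one]
      change p * x j ≤ q * x i0
      have hxj : x j ≤ 1 - x i0 := by
        rw [← Finset.add_sum_erase _ _ (Finset.mem_univ i0)] at x1
        have : x j ≤ ∑ i ∈ Finset.univ.erase i0, x i :=
          Finset.single_le_sum (fun j _ => x0 j) (Finset.mem_erase.2 ⟨hj, Finset.mem_univ _⟩)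
        linarith
      have := mul_le_mul_of_nonneg_left hxj hppos.le
      linarith
    · rw [if_neg hi, mul_zero, zero_add]
      exact mul_le_mul_of_nonneg_left (h3 hij') hq.le

/-- von Neumann entropy is a measurement Ωⁿ → [0,∞)*: Scott continuous, its kernel is
exactly the maximal (pure) states, and it measures the content of every pure state. -/
theorem von_neumann_entropy_measurement (n : ℕ) (hn : 2 ≤ n) :
    (∀ ρ τ : QState n, qLE ρ τ → vnEntropy τ ≤ vnEntropy ρ) ∧
    (∀ S : Set (QState n), S.Nonempty → DirectedOn qLE S →
      ∀ a : QState n, IsLub' qLE S a → vnEntropy a = sInf (vnEntropy '' S)) ∧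
    (∀ ρ : QState n, vnEntropy ρ = 0 ↔ (∀ τ, qLE ρ τ → τ = ρ)) ∧
    (∀ ρ : QState n, IsPureState ρ.val →
      ∀ U : Set (QState n), ScottOpen qLE U → ρ ∈ U →
        ∃ ε > (0 : ℝ), {τ : QState n | qLE τ ρ ∧ vnEntropy τ < ε} ⊆ U) := by
  exact ⟨fun ρ τ h => entropy_mono h, entropy_scott, entropy_zero_iff hn, measures hn⟩
end
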